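/- arXiv:0712.1398 — 2 statements merged into one kernel-verified Lean document; each statement's English description precedes it below -/
import Mathlib

section
/- Let g ⊊ so(V) be a proper Lie subalgebra acting irreducibly on V with n = dim V > 4. If F ∈ so(V) satisfies [F, g^⊥] ⊆ g and L*_F T^g = 0 (where F is identified with its 2-form), then F = 0. -/
open scoped RealInnerProductSpace BigOperators

noncomputable section

variable {V : Type} [NormedAddCommGroup V] [InnerProductSpace ℝ V] [FiniteDimensional ℝ V]

/-- A skew-symmetric endomorphism of a real inner product space. -/
def IsSkew (A : V →ₗ[ℝ] V) : Prop := ∀ x y : V, ⟪A x, y⟫ = - ⟪x, A y⟫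

/-- The inner product on `Λ²V ≅ so(V)` for which `{eᵢ∧eⱼ : i<j}` is orthonormal,
computed in the standard orthonormal basis of `V`. -/
def formInner (F G : V → V) : ℝ :=
  ∑ i, ∑ j ∈ Finset.Ioi i,
    ⟪F (stdOrthonormalBasis ℝ V i), stdOrthonormalBasis ℝ V j⟫ *
      ⟪G (stdOrthonormalBasis ℝ V i), stdOrthonormalBasis ℝ V j⟫

/-- `(α ∧ α)(X,Y,Z,W)` where `α` is the 2-form of the skew endomorphism `A`. -/
def wedgeSelf (A : V →ₗ[ℝ] V) (X Y Z W : V) : ℝ :=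
  ⟪A X, Y⟫ * ⟪A Z, W⟫ - ⟪A X, Z⟫ * ⟪A Y, W⟫ + ⟪A X, W⟫ * ⟪A Y, Z⟫ +
    ⟪A Y, Z⟫ * ⟪A X, W⟫ - ⟪A Y, W⟫ * ⟪A X, Z⟫ + ⟪A Z, W⟫ * ⟪A X, Y⟫


set_option linter.unusedSectionVars false

/-- The inner product on endomorphisms. -/
def ip : (V →ₗ[ℝ] V) →ₗ[ℝ] (V →ₗ[ℝ] V) →ₗ[ℝ] ℝ :=
  LinearMap.mk₂ ℝ (fun A B => (1/2) * ∑ i, ⟪A (stdOrthonormalBasis ℝ V i), B (stdOrthonormalBasis ℝ V i)⟫)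
    (by intro A A' B; simp [inner_add_left, Finset.sum_add_distrib]; ring)
    (by intro c A B; simp [inner_smul_left, ← Finset.mul_sum]; ring)
    (by intro A B B'; simp [inner_add_right, Finset.sum_add_distrib]; ring)
    (by intro c A B; simp [inner_smul_right, ← Finset.mul_sum]; ring)

theorem ip_def (A B : V →ₗ[ℝ] V) : ip A B =
    (1/2) * ∑ i, ⟪A (stdOrthonormalBasis ℝ V i), B (stdOrthonormalBasis ℝ V i)⟫ := rfl

theorem ip_comm (A B : V →ₗ[ℝ] V) : ip A B = ip B A := by
  simp [ip_def, real_inner_comm]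

theorem ip_nonneg (A : V →ₗ[ℝ] V) : 0 ≤ ip A A := by
  rw [ip_def]
  have : 0 ≤ ∑ i, ⟪A (stdOrthonormalBasis ℝ V i), A (stdOrthonormalBasis ℝ V i)⟫ :=
    Finset.sum_nonneg fun i _ => real_inner_self_nonneg
  linarith

theorem ip_self_zero {A : V →ₗ[ℝ] V} (h : ip A A = 0) : A = 0 := by
  rw [ip_def] at h
  have h1 : ∑ i, ⟪A (stdOrthonormalBasis ℝ V i), A (stdOrthonormalBasis ℝ V i)⟫ = 0 := by linarith
  rw [Finset.sum_eq_zero_iff_of_nonneg (fun i _ => real_inner_self_nonneg)] at h1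
  apply (stdOrthonormalBasis ℝ V).toBasis.ext
  intro i
  have := h1 i (Finset.mem_univ i)
  simpa using this

theorem ip_trace {A : V →ₗ[ℝ] V} (hA : IsSkew A) (B : V →ₗ[ℝ] V) :
    ip A B = -(1/2) * LinearMap.trace ℝ V (A * B) := by
  rw [ip_def, LinearMap.trace_eq_sum_inner _ (stdOrthonormalBasis ℝ V)]
  have : ∀ i, ⟪A (stdOrthonormalBasis ℝ V i), B (stdOrthonormalBasis ℝ V i)⟫
     = - ⟪(stdOrthonormalBasis ℝ V i), (A * B) (stdOrthonormalBasis ℝ V i)⟫ := by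
    intro i; rw [hA]; rfl
  simp only [this, Finset.sum_neg_distrib]; ring

theorem skew_inner_self {A : V →ₗ[ℝ] V} (hA : IsSkew A) (x : V) : ⟪A x, x⟫ = 0 := by
  have := hA x x
  rw [real_inner_comm x] at this ⊢
  linarith

theorem sum_Ioi_symm {n : ℕ} (f : Fin n → Fin n → ℝ) (hs : ∀ i j, f i j = f j i)
    (hd : ∀ i, f i i = 0) : ∑ i, ∑ j ∈ Finset.Ioi i, f i j = (1/2) * ∑ i, ∑ j, f i j := by
  have h1 : ∀ i, ∑ j, f i j = ∑ j ∈ Finset.Ioi i, f i j + ∑ j ∈ Finset.Iio i, f i j := by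
    intro i
    have : (Finset.univ : Finset (Fin n)) = Finset.Ioi i ∪ (Finset.Iio i ∪ {i}) := by
      ext j; simp; grind
    rw [this, Finset.sum_union, Finset.sum_union]
    · simp [hd]
    · simp
    · rw [Finset.disjoint_left]; intro j; simp
  have h2 : ∑ i, ∑ j ∈ Finset.Iio i, f i j = ∑ i, ∑ j ∈ Finset.Ioi i, f i j := by
    rw [Finset.sum_comm' (t' := Finset.univ) (s' := fun j => Finset.Ioi j)]
    · simp_rw [hs]
      
    · intro x y; simp
  simp only [h1, Finset.sum_add_distrib, h2]; ring

theorem ip_formInner {A B : V →ₗ[ℝ] V} (hA : IsSkew A) (hB : IsSkew B) :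
    formInner (⇑A) (⇑B) = ip A B := by
  unfold formInner
  rw [sum_Ioi_symm, ip_def]
  · congr 1
    apply Finset.sum_congr rfl
    intro i _
    rw [← (stdOrthonormalBasis ℝ V).sum_inner_mul_inner (A _) (B _)]
    apply Finset.sum_congr rfl
    intro j _
    rw [real_inner_comm (B _)]
  · intro i j
    rw [hA, hB, real_inner_comm, real_inner_comm _ (B _)]; ring
  · intro i; rw [skew_inner_self hA]; simp

/-- bracket -/
def br (A B : V →ₗ[ℝ] V) : V →ₗ[ℝ] V := A * B - B * A

theorem br_apply (A B : V →ₗ[ℝ] V) (x : V) : br A B x = A (B x) - B (A x) := rfl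

theorem br_jac (A B C : V →ₗ[ℝ] V) : br A (br B C) = br (br A B) C + br B (br A C) := by
  unfold br; noncomm_ring

theorem br_swap (A B : V →ₗ[ℝ] V) : br A B = - br B A := by
  unfold br; noncomm_ring

theorem br_self (A : V →ₗ[ℝ] V) : br A A = 0 := by
  unfold br; noncomm_ring

theorem br_add (A B C : V →ₗ[ℝ] V) : br A (B + C) = br A B + br A C := by
  unfold br; noncomm_ring

theorem add_br (A B C : V →ₗ[ℝ] V) : br (A + B) C = br A C + br B C := by
  unfold br; noncomm_ring

theorem br_smul (c : ℝ) (A B : V →ₗ[ℝ] V) : br A (c • B) = c • br A B := by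
  simp [br, smul_sub]

theorem smul_br (c : ℝ) (A B : V →ₗ[ℝ] V) : br (c • A) B = c • br A B := by
  simp [br, smul_sub]

/-- ad as a linear map -/
def adL : (V →ₗ[ℝ] V) →ₗ[ℝ] (V →ₗ[ℝ] V) →ₗ[ℝ] (V →ₗ[ℝ] V) :=
  LinearMap.mk₂ ℝ br add_br smul_br br_add br_smul

theorem adL_apply (A B : V →ₗ[ℝ] V) : adL A B = br A B := rfl

theorem br_sum {ι : Type*} (s : Finset ι) (A : V →ₗ[ℝ] V) (f : ι → V →ₗ[ℝ] V) :
    br A (∑ i ∈ s, f i) = ∑ i ∈ s, br A (f i) := map_sum (adL A) f s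

theorem sum_br {ι : Type*} (s : Finset ι) (A : V →ₗ[ℝ] V) (f : ι → V →ₗ[ℝ] V) :
    br (∑ i ∈ s, f i) A = ∑ i ∈ s, br (f i) A := by
  rw [br_swap, br_sum, ← Finset.sum_neg_distrib]
  exact Finset.sum_congr rfl fun i _ => (br_swap _ _).symm

theorem br_zero (A : V →ₗ[ℝ] V) : br A 0 = 0 := by simp [br]
theorem zero_br (A : V →ₗ[ℝ] V) : br 0 A = 0 := by simp [br]
theorem br_sub (A B C : V →ₗ[ℝ] V) : br A (B - C) = br A B - br A C := by
  unfold br; noncomm_ring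
theorem sub_br (A B C : V →ₗ[ℝ] V) : br (A - B) C = br A C - br B C := by
  unfold br; noncomm_ring
theorem br_neg (A B : V →ₗ[ℝ] V) : br A (-B) = - br A B := by
  unfold br; noncomm_ring
theorem neg_br (A B : V →ₗ[ℝ] V) : br (-A) B = - br A B := by
  unfold br; noncomm_ring

theorem br_skew {A B : V →ₗ[ℝ] V} (hA : IsSkew A) (hB : IsSkew B) : IsSkew (br A B) := by
  intro x y
  simp only [br_apply, inner_sub_left, inner_sub_right]
  rw [hA, hB, hB, hA]; ring

theorem ip_inv {A B C : V →ₗ[ℝ] V} (hA : IsSkew A) (hB : IsSkew B) :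
    ip (br A B) C = - ip B (br A C) := by
  rw [ip_trace (br_skew hA hB), ip_trace hB]
  unfold br
  simp only [sub_mul, mul_sub, map_sub]
  have h1 : LinearMap.trace ℝ V (A * B * C) = LinearMap.trace ℝ V (B * (C * A)) := by
    rw [mul_assoc, LinearMap.trace_mul_comm, mul_assoc]
  rw [h1, mul_assoc]; ring

/-- skew endomorphisms as a submodule -/
def so (V : Type) [NormedAddCommGroup V] [InnerProductSpace ℝ V] : Submodule ℝ (V →ₗ[ℝ] V) where
  carrier := {A | IsSkew A}
  zero_mem' := by intro x y; simp
  add_mem' := by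
    intro A B hA hB x y
    simp only [LinearMap.add_apply, inner_add_left, inner_add_right]
    rw [hA, hB]; ring
  smul_mem' := by
    intro c A hA x y
    simp only [LinearMap.smul_apply, inner_smul_left, inner_smul_right]
    rw [hA]; simp

theorem mem_so {A : V →ₗ[ℝ] V} : A ∈ so V ↔ IsSkew A := Iff.rfl

/-- x ∧ y -/
def wd (x y : V) : V →ₗ[ℝ] V :=
  (innerₛₗ ℝ x).smulRight y - (innerₛₗ ℝ y).smulRight x

theorem wd_apply (x y z : V) : wd x y z = ⟪x, z⟫ • y - ⟪y, z⟫ • x := by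
  simp [wd]

theorem wd_skew (x y : V) : IsSkew (wd x y) := by
  intro z w
  simp only [wd_apply, inner_sub_left, inner_sub_right, inner_smul_left, inner_smul_right]
  rw [real_inner_comm z y, real_inner_comm z x]
  simp; ring

theorem wd_add (x y z : V) : wd x (y + z) = wd x y + wd x z := by
  ext w; simp only [wd_apply, LinearMap.add_apply, inner_add_left, add_smul, smul_add]; abel
theorem wd_smul (c : ℝ) (x y : V) : wd x (c • y) = c • wd x y := by
  ext w; simp only [wd_apply, LinearMap.smul_apply, inner_smul_left, smul_sub, smul_smul]
  simp [mul_comm]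
theorem wd_swap (x y : V) : wd x y = - wd y x := by
  ext w; simp [wd_apply]
theorem wd_self (x : V) : wd x x = 0 := by
  ext w; simp [wd_apply]
theorem wd_sub (x y z : V) : wd x (y - z) = wd x y - wd x z := by
  ext w; simp only [wd_apply, LinearMap.sub_apply, inner_sub_left, sub_smul, smul_sub]; abel
theorem add_wd (x y z : V) : wd (x + y) z = wd x z + wd y z := by
  rw [wd_swap, wd_add, wd_swap x, wd_swap y]; abel
theorem smul_wd (c : ℝ) (x y : V) : wd (c • x) y = c • wd x y := by
  rw [wd_swap, wd_smul, wd_swap x]; simp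
theorem sub_wd (x y z : V) : wd (x - y) z = wd x z - wd y z := by
  rw [wd_swap, wd_sub, wd_swap x, wd_swap y]; abel
theorem wd_zero (x : V) : wd x 0 = 0 := by
  ext w; simp [wd_apply]

theorem br_wd {A : V →ₗ[ℝ] V} (hA : IsSkew A) (x y : V) :
    br A (wd x y) = wd (A x) y + wd x (A y) := by
  ext z
  simp only [br_apply, wd_apply, LinearMap.add_apply, map_sub, map_smul]
  have h1 : ⟪A x, z⟫ = - ⟪x, A z⟫ := hA _ _
  have h2 : ⟪A y, z⟫ = - ⟪y, A z⟫ := hA _ _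
  rw [h1, h2]; simp only [neg_smul]; abel

theorem ip_wd {A : V →ₗ[ℝ] V} (hA : IsSkew A) (x y : V) : ip A (wd x y) = ⟪A x, y⟫ := by
  rw [ip_def]
  simp only [wd_apply, inner_sub_right, inner_smul_right, Finset.sum_sub_distrib]
  have key : ∀ x y : V, ∑ i, ⟪x, stdOrthonormalBasis ℝ V i⟫ * ⟪A (stdOrthonormalBasis ℝ V i), y⟫
      = ⟪A x, y⟫ := by
    intro x y
    rw [hA x y, ← (stdOrthonormalBasis ℝ V).sum_inner_mul_inner, ← Finset.sum_neg_distrib]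
    apply Finset.sum_congr rfl
    intro i _
    rw [hA]; ring
  rw [key, key, hA y x, real_inner_comm]; ring

theorem exists_onb (W : Submodule ℝ (V →ₗ[ℝ] V)) :
    ∃ X : Fin (Module.finrank ℝ W) → (V →ₗ[ℝ] V), (∀ l, X l ∈ W) ∧
      (∀ k l, ip (X k) (X l) = if k = l then 1 else 0) ∧
      ∀ Z ∈ W, Z = ∑ l, ip Z (X l) • X l := by
  let core : InnerProductSpace.Core ℝ (V →ₗ[ℝ] V) :=
    { inner := fun A B => ip A B
      conj_inner_symm := by intro A B; simp [ip_comm]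
      re_inner_nonneg := by intro A; simpa using ip_nonneg A
      add_left := by intro A B C; simp
      smul_left := by intro A B c; simp
      definite := by intro A h; exact ip_self_zero h }
  letI : NormedAddCommGroup (V →ₗ[ℝ] V) := core.toNormedAddCommGroup
  letI : InnerProductSpace ℝ (V →ₗ[ℝ] V) := InnerProductSpace.ofCore core.toCore
  let b := stdOrthonormalBasis ℝ W
  have hin : ∀ A B : V →ₗ[ℝ] V, inner ℝ A B = ip A B := fun A B => rfl
  refine ⟨fun l => (b l : V →ₗ[ℝ] V), fun l => (b l).2, ?_, ?_⟩
  · intro k l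
    have := orthonormal_iff_ite.1 b.orthonormal k l
    rw [← this]; rfl
  · intro Z hZ
    have := b.sum_repr' ⟨Z, hZ⟩
    have h2 := congrArg (Subtype.val) this
    simp only [Submodule.coe_sum, Submodule.coe_smul] at h2
    rw [← h2]
    apply Finset.sum_congr rfl
    intro l _
    rw [ip_comm]
    congr 1
    rw [h2]; rfl

theorem exists_decomp (W : Submodule ℝ (V →ₗ[ℝ] V)) (Z : V →ₗ[ℝ] V) :
    ∃ P ∈ W, ∀ Y ∈ W, ip (Z - P) Y = 0 := by
  obtain ⟨X, hX, hon, hspan⟩ := exists_onb W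
  refine ⟨∑ l, ip Z (X l) • X l, Submodule.sum_mem _ fun l _ => W.smul_mem _ (hX l), ?_⟩
  intro Y hY
  have h : ∀ k, ip (Z - ∑ l, ip Z (X l) • X l) (X k) = 0 := by
    intro k
    simp [hon]
  rw [hspan Y hY]
  simp only [map_sum, map_smul, h]; simp

theorem exists_orth {k : ℕ} (f : Fin k → V) (hk : k < Module.finrank ℝ V) :
    ∃ u : V, ‖u‖ = 1 ∧ ∀ i, ⟪u, f i⟫ = 0 := by
  have h1 : Module.finrank ℝ (Submodule.span ℝ (Set.range f)) ≤ k := by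
    have := finrank_range_le_card (R := ℝ) f
    rw [Fintype.card_fin] at this
    exact this
  have h2 := (Submodule.span ℝ (Set.range f)).finrank_add_finrank_orthogonal
  have h3 : (Submodule.span ℝ (Set.range f))ᗮ ≠ ⊥ := by
    intro h; rw [h] at h2; simp at h2; omega
  obtain ⟨v, hv, hv0⟩ := Submodule.exists_mem_ne_zero_of_ne_bot h3
  refine ⟨(‖v‖⁻¹ : ℝ) • v, ?_, ?_⟩
  · rw [norm_smul]; simp [hv0]
  · intro i
    have := (Submodule.mem_orthogonal' _ _).1 hv (f i) (Submodule.subset_span ⟨i, rfl⟩)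
    rw [inner_smul_left, this]; simp

theorem eq_zero_of_wd {A : V →ₗ[ℝ] V} (hA : IsSkew A) (h : ∀ x y, ip A (wd x y) = 0) : A = 0 := by
  ext x
  have := h x (A x)
  rw [ip_wd hA] at this
  simpa using this

theorem wd_all_mem {I : Submodule ℝ (V →ₗ[ℝ] V)} {x : V} (hx : ‖x‖ = 1)
    (hbr : ∀ A ∈ I, ∀ B ∈ I, br A B ∈ I)
    (h : ∀ z, wd x z ∈ I) (u v : V) : wd u v ∈ I := by
  have hxx : ⟪x, x⟫ = 1 := by rw [real_inner_self_eq_norm_sq, hx]; norm_num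
  have h1 := hbr _ (h u) _ (h v)
  rw [br_wd (wd_skew _ _), wd_apply, wd_apply, wd_sub, wd_smul, wd_smul, wd_self, hxx] at h1
  have e : wd u v = (wd ((1:ℝ) • u - ⟪u, x⟫ • x) v + (⟪x, v⟫ • wd x u - ⟪u, v⟫ • 0)) 
     + ⟪u, x⟫ • wd x v - ⟪x, v⟫ • wd x u := by
    rw [sub_wd, smul_wd, smul_wd]; simp; abel
  rw [e]
  exact I.sub_mem (I.add_mem h1 (I.smul_mem _ (h v))) (I.smul_mem _ (h u))

theorem all_mem_of_wd {I : Submodule ℝ (V →ₗ[ℝ] V)} (hI : ∀ A ∈ I, IsSkew A)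
    (h : ∀ x y, wd x y ∈ I) (A : V →ₗ[ℝ] V) (hA : IsSkew A) : A ∈ I := by
  obtain ⟨P, hP, hP2⟩ := exists_decomp I A
  have : A - P = 0 := by
    apply eq_zero_of_wd
    · exact (so V).sub_mem (mem_so.2 hA) (mem_so.2 (hI P hP))
    · intro x y; exact hP2 _ (h x y)
  rw [sub_eq_zero] at this
  rwa [this]

theorem so_simple (hn : 4 < Module.finrank ℝ V) (I : Submodule ℝ (V →ₗ[ℝ] V))
    (hI : ∀ A ∈ I, IsSkew A) (hid : ∀ A ∈ I, ∀ B, IsSkew B → br A B ∈ I) :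
    (∀ A ∈ I, A = 0) ∨ (∀ A, IsSkew A → A ∈ I) := by
  by_cases hex : ∃ x y : V, ‖x‖ = 1 ∧ ‖y‖ = 1 ∧ ⟪x, y⟫ = 0 ∧ wd x y ∈ I
  · right
    obtain ⟨x, y, hx, hy, hxy, hm⟩ := hex
    have hxx : ⟪x, x⟫ = 1 := by rw [real_inner_self_eq_norm_sq, hx]; norm_num
    have hyy : ⟪y, y⟫ = 1 := by rw [real_inner_self_eq_norm_sq, hy]; norm_num
    have hyx : ⟪y, x⟫ = 0 := by rw [real_inner_comm]; exact hxy
    apply all_mem_of_wd hI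
    apply wd_all_mem hx (fun A hA B hB => hid A hA B (hI B hB))
    intro z
    have h1 := hid _ hm (wd y z) (wd_skew _ _)
    rw [br_wd (wd_skew _ _), wd_apply, wd_apply, hxy, hyy, wd_sub, wd_smul, wd_smul, wd_self] at h1
    have e : wd x z = -(wd ((0:ℝ) • y - (1:ℝ) • x) z + (⟪x, z⟫ • 0 - ⟪y, z⟫ • wd y x))
       + ⟪y, z⟫ • wd x y := by
      rw [sub_wd, smul_wd, smul_wd, wd_swap y x]; simp
    rw [e]
    exact I.add_mem (I.neg_mem h1) (I.smul_mem _ hm)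
  · left
    push Not at hex
    intro A hA
    -- every orthonormal wedge is orthogonal to I
    have key : ∀ x y : V, ‖x‖ = 1 → ‖y‖ = 1 → ⟪x, y⟫ = 0 → ip A (wd x y) = 0 := by
      intro x y hx hy hxy
      have hxx : ⟪x, x⟫ = 1 := by rw [real_inner_self_eq_norm_sq, hx]; norm_num
      have hyy : ⟪y, y⟫ = 1 := by rw [real_inner_self_eq_norm_sq, hy]; norm_num
      have hyx : ⟪y, x⟫ = 0 := by rw [real_inner_comm]; exact hxy
      obtain ⟨s, hs, hk⟩ := exists_decomp I (wd x y)
      have hsk := hI s hs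
      set k := wd x y - s with hkdef
      have hkk : IsSkew k := (so V).sub_mem (mem_so.2 (wd_skew x y)) (mem_so.2 hsk)
      -- I and its complement
      have hcomp : ∀ r, IsSkew r → br r (wd x y) = 0 → br r s = 0 := by
        intro r hr h0
        have e1 : br r s = - br r k := by
          rw [hkdef, br_sub, h0]; simp
        apply ip_self_zero
        have hm : br r s ∈ I := by
          rw [br_swap]; exact I.neg_mem (hid s hs r hr)
        have hm2 : br r (br r s) ∈ I := by
          rw [br_swap]; exact I.neg_mem (hid _ hm r hr)
        conv_lhs => arg 1; rw [e1]
        simp only [map_neg, LinearMap.neg_apply]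
        rw [ip_inv hr hkk, hk _ hm2]; simp
      have hsw : br s (wd x y) = 0 := by
        have : br (wd x y) s = 0 := hcomp _ (wd_skew _ _) (br_self _)
        rw [br_swap, this]; simp
      rw [br_wd hsk] at hsw
      have sv : ∀ v, ⟪v, x⟫ = 0 → ⟪v, y⟫ = 0 → s v = 0 := by
        intro v hvx hvy
        have aux : ∀ u, ‖u‖ = 1 → ⟪u, x⟫ = 0 → ⟪u, y⟫ = 0 → ⟪u, v⟫ = 0 → s v = ⟪s v, u⟫ • u := by
          intro u hu hux huy huv
          have huu : ⟪u, u⟫ = 1 := by rw [real_inner_self_eq_norm_sq, hu]; norm_num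
          have h0 : br (wd u v) (wd x y) = 0 := by
            rw [br_wd (wd_skew _ _), wd_apply, wd_apply, hux, hvx, huy, hvy]
            simp [wd_zero, wd_swap _ y]
          have h1 : br s (wd u v) = 0 := by
            rw [br_swap, hcomp _ (wd_skew _ _) h0]; simp
          rw [br_wd hsk] at h1
          have h2 := congrArg (fun B => B u) h1
          simp only [LinearMap.add_apply, wd_apply, skew_inner_self hsk, huu,
            real_inner_comm u v] at h2
          rw [huv] at h2
          simp at h2
          exact sub_eq_zero.1 h2
        obtain ⟨u, hu, hu2⟩ := exists_orth ![x, y, v] (by omega)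
        obtain ⟨w, hw, hw2⟩ := exists_orth ![x, y, v, u] (by omega)
        have a1 := aux u hu (hu2 0) (hu2 1) (hu2 2)
        have a2 := aux w hw (hw2 0) (hw2 1) (hw2 2)
        have hwu : ⟪w, u⟫ = 0 := hw2 3
        have : ⟪s v, u⟫ = 0 := by
          rw [a2, inner_smul_left, hwu]; simp
        rw [a1, this]; simp
      have hsx : s x = ⟪s x, y⟫ • y := by
        have h2 := congrArg (fun B => B y) hsw
        simp only [LinearMap.add_apply, wd_apply, skew_inner_self hsk, hyy, hxy, LinearMap.zero_apply] at h2
        simp at h2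
        have h3 : ⟪s x, y⟫ • y - s x = 0 := by simpa using h2
        exact (sub_eq_zero.1 h3).symm
      have hsy : s y = - ⟪s x, y⟫ • x := by
        have h2 := congrArg (fun B => B x) hsw
        simp only [LinearMap.add_apply, wd_apply, skew_inner_self hsk, hxx, hyx, LinearMap.zero_apply] at h2
        simp at h2
        have h3 := sub_eq_zero.1 h2
        rw [h3, hsk y x, real_inner_comm]
      have hs_eq : s = ⟪s x, y⟫ • wd x y := by
        ext z
        have hz := sv (z - ⟪x, z⟫ • x - ⟪y, z⟫ • y)
          (by simp [inner_sub_left, inner_smul_left, hx, hyx, real_inner_comm])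
          (by simp [inner_sub_left, inner_smul_left, hy, hxy, real_inner_comm])
        simp only [map_sub, map_smul] at hz
        rw [sub_sub, sub_eq_zero] at hz
        rw [hz, hsy]
        nth_rw 1 [hsx]
        simp only [LinearMap.smul_apply, wd_apply, smul_sub, smul_smul, neg_smul, smul_neg]
        simp [mul_comm, sub_eq_add_neg]
      have hl : ⟪s x, y⟫ = 0 := by
        by_contra hne
        apply hex x y hx hy hxy
        have : wd x y = (⟪s x, y⟫)⁻¹ • s := by
          nth_rw 2 [hs_eq]; rw [smul_smul, inv_mul_cancel₀ hne, one_smul]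
        rw [this]; exact I.smul_mem _ hs
      have hs0 : s = 0 := by rw [hs_eq, hl]; simp
      have := hk A hA
      rw [hkdef, hs0, sub_zero] at this
      rw [ip_comm]; exact this
    have hAs := hI A hA
    ext x
    by_contra hne
    have hAx : A x ≠ 0 := hne
    have hx : x ≠ 0 := by rintro rfl; simp at hAx
    have h1 := key ((‖x‖⁻¹ : ℝ) • x) ((‖A x‖⁻¹ : ℝ) • A x)
      (by rw [norm_smul]; simp [hx]) (by rw [norm_smul]; simp [hAx])
      (by rw [inner_smul_left, inner_smul_right, real_inner_comm, skew_inner_self hAs]; simp)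
    rw [ip_wd hAs, map_smul, inner_smul_left, inner_smul_right] at h1
    simp [hx, hAx] at h1

theorem finrank_map_add {E F : Type*} [AddCommGroup E] [Module ℝ E] [FiniteDimensional ℝ E]
    [AddCommGroup F] [Module ℝ F] (f : E →ₗ[ℝ] F) (p : Submodule ℝ E) :
    Module.finrank ℝ (p.map f) + Module.finrank ℝ (p ⊓ LinearMap.ker f : Submodule ℝ E)
      = Module.finrank ℝ p := by
  have h := LinearMap.finrank_range_add_finrank_ker (f.domRestrict p)
  rw [LinearMap.range_domRestrict, LinearMap.ker_domRestrict] at h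
  rw [← h]
  congr 1
  have e : (LinearMap.ker f).comap p.subtype = (p ⊓ LinearMap.ker f).comap p.subtype := by
    ext x; simp
  rw [e]
  exact (Submodule.comapSubtypeEquivOfLe inf_le_left).symm.finrank_eq

theorem exists_abelian : ∀ (d : ℕ) (m g : Submodule ℝ (V →ₗ[ℝ] V)), Module.finrank ℝ m ≤ d →
    (∀ A ∈ m, IsSkew A) → (∀ A ∈ g, IsSkew A) →
    (∀ A ∈ m, ∀ B ∈ m, br A B ∈ g) → (∀ A ∈ m, ∀ B ∈ g, br A B ∈ m) →
    ∃ a : Submodule ℝ (V →ₗ[ℝ] V), a ≤ m ∧ (∀ A ∈ a, ∀ B ∈ a, br A B = 0) ∧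
      Module.finrank ℝ m ≤ Module.finrank ℝ g + Module.finrank ℝ a := by
  intro d
  induction d with
  | zero =>
    intro m g hd _ _ _ _
    exact ⟨⊥, bot_le, by intro A hA B _; rw [(Submodule.mem_bot ℝ).1 hA, zero_br], by omega⟩
  | succ d ih =>
    intro m g hd hm hg hmm hmg
    by_cases hab : ∀ A ∈ m, ∀ B ∈ m, br A B = 0
    · exact ⟨m, le_rfl, hab, by omega⟩
    · push Not at hab
      obtain ⟨Y, hY, B, hB, hne⟩ := hab
      have r1 := finrank_map_add (adL Y) m
      have r2 := finrank_map_add (adL Y) g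
      set m' := m ⊓ LinearMap.ker (adL Y) with hm'
      set g' := g ⊓ LinearMap.ker (adL Y) with hg'
      have hlt : Module.finrank ℝ m' < Module.finrank ℝ m := by
        apply Submodule.finrank_lt_finrank_of_lt
        refine lt_of_le_of_ne inf_le_left ?_
        intro h
        have : B ∈ m' := by rw [h]; exact hB
        exact hne (LinearMap.mem_ker.1 this.2)
      have hsk := hm Y hY
      -- rank comparison
      have hinj : Module.finrank ℝ (m.map (adL Y)) ≤ Module.finrank ℝ (g.map (adL Y)) := by
        have r3 := finrank_map_add (adL Y) (m.map (adL Y))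
        have : (m.map (adL Y)) ⊓ LinearMap.ker (adL Y) = ⊥ := by
          rw [eq_bot_iff]
          rintro _ ⟨⟨x, hx, rfl⟩, h2⟩
          have h3 : br Y (br Y x) = 0 := LinearMap.mem_ker.1 h2
          rw [Submodule.mem_bot]
          apply ip_self_zero
          rw [adL_apply, ip_inv hsk (hm x hx), h3]; simp
        rw [this] at r3
        simp only [finrank_bot] at r3
        rw [← r3, add_zero]
        apply Submodule.finrank_mono
        apply Submodule.map_mono
        rintro _ ⟨x, hx, rfl⟩
        exact hmm Y hY x hx
      have ker_br : ∀ A C, A ∈ LinearMap.ker (adL Y) → C ∈ LinearMap.ker (adL Y) →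
          br A C ∈ LinearMap.ker (adL Y) := by
        intro A C hA hC
        rw [LinearMap.mem_ker, adL_apply] at *
        rw [br_jac, hA, hC, zero_br, br_zero, add_zero]
      obtain ⟨a, ha, hab, hfin⟩ := ih m' g' (by omega) (fun A hA => hm A hA.1)
        (fun A hA => hg A hA.1)
        (fun A hA C hC => ⟨hmm A hA.1 C hC.1, ker_br A C hA.2 hC.2⟩)
        (fun A hA C hC => ⟨hmg A hA.1 C hC.1, ker_br A C hA.2 hC.2⟩)
      exact ⟨a, ha.trans inf_le_left, hab, by omega⟩

/-- joint eigenvector for an abelian family -/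
theorem exists_joint (a : Submodule ℝ (V →ₗ[ℝ] V)) (hsk : ∀ A ∈ a, IsSkew A)
    (hab : ∀ A ∈ a, ∀ B ∈ a, br A B = 0) (A : V →ₗ[ℝ] V) (hA : A ∈ a) (hA0 : A ≠ 0) :
    ∃ e : V, ‖e‖ = 1 ∧ A e ≠ 0 ∧ ∀ B ∈ a, ∀ C ∈ a, ∃ l : ℝ, B (C e) = l • e := by
  have hcomm : ∀ B ∈ a, ∀ C ∈ a, B * C = C * B := fun B hB C hC => sub_eq_zero.1 (hab B hB C hC)
  let T : a × a → (V →ₗ[ℝ] V) := fun p => p.1.1 * p.2.1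
  have hT : ∀ i, (T i).IsSymmetric := by
    rintro ⟨B, C⟩ x y
    change ⟪B.1 (C.1 x), y⟫ = ⟪x, B.1 (C.1 y)⟫
    have : B.1 (C.1 y) = C.1 (B.1 y) := congrArg (fun f => f y) (hcomm B.1 B.2 C.1 C.2)
    rw [hsk _ B.2, hsk _ C.2, this]; ring
  have hC : Pairwise (Function.onFun Commute T) := by
    rintro ⟨B, C⟩ ⟨D, E⟩ _
    have c : ∀ X Y : a, Commute X.1 Y.1 := fun X Y => hcomm X.1 X.2 Y.1 Y.2
    exact ((c B D).mul_right (c B E)).mul_left ((c C D).mul_right (c C E))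
  have htop := LinearMap.IsSymmetric.iSup_iInf_eq_top_of_commute hT hC
  have hex : ∃ χ : a × a → ℝ, ∃ e ∈ (⨅ i, Module.End.eigenspace (T i) (χ i) : Submodule ℝ V),
      A e ≠ 0 := by
    by_contra hcon
    push Not at hcon
    apply hA0
    have : (⊤ : Submodule ℝ V) ≤ LinearMap.ker A := by
      rw [← htop]
      exact iSup_le fun χ x hx => hcon χ x hx
    ext x
    exact this (Submodule.mem_top (x := x))
  obtain ⟨χ, e, he, hAe⟩ := hex
  have he0 : e ≠ 0 := by rintro rfl; simp at hAe
  refine ⟨(‖e‖⁻¹ : ℝ) • e, ?_, ?_, ?_⟩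
  · rw [norm_smul]; simp [he0]
  · rw [map_smul]; simp [he0, hAe]
  · intro B hB C hC
    refine ⟨χ (⟨B, hB⟩, ⟨C, hC⟩), ?_⟩
    have h1 := (Submodule.mem_iInf _).1 he (⟨B, hB⟩, ⟨C, hC⟩)
    have h2 : B (C e) = χ (⟨B, hB⟩, ⟨C, hC⟩) • e := Module.End.mem_eigenspace_iff.1 h1
    rw [map_smul, map_smul, h2, smul_comm]

theorem exists_rank_two : ∀ (d : ℕ) (U : Submodule ℝ V) (a : Submodule ℝ (V →ₗ[ℝ] V)),
    Module.finrank ℝ U ≤ d → (∀ A ∈ a, IsSkew A) →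
    (∀ A ∈ a, ∀ B ∈ a, br A B = 0) → (∀ A ∈ a, ∀ x ∈ Uᗮ, A x = 0) → a ≠ ⊥ →
    Module.finrank ℝ U ≤ 2 * Module.finrank ℝ a →
    ∃ e f : V, ‖e‖ = 1 ∧ ‖f‖ = 1 ∧ ⟪e, f⟫ = 0 ∧ wd e f ∈ a := by
  intro d
  induction d with
  | zero =>
    intro U a hd hsk hab hU ha _
    exfalso
    obtain ⟨A, hA, hA0⟩ := Submodule.exists_mem_ne_zero_of_ne_bot ha
    apply hA0
    ext x
    apply hU A hA
    have : U = ⊥ := by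
      rw [← Submodule.finrank_eq_zero (R := ℝ)]; omega
    rw [this]; simp
  | succ d ih =>
    intro U a hd hsk hab hU ha hdim
    obtain ⟨A0, hA0, hA00⟩ := Submodule.exists_mem_ne_zero_of_ne_bot ha
    obtain ⟨e, he, hAe, hj⟩ := exists_joint a hsk hab A0 hA0 hA00
    have hee : ⟪e, e⟫ = 1 := by rw [real_inner_self_eq_norm_sq, he]; norm_num
    -- normalise
    obtain ⟨C, hC, f, hf, hCe⟩ : ∃ C ∈ a, ∃ f, ‖f‖ = 1 ∧ C e = f :=
      ⟨(‖A0 e‖⁻¹ : ℝ) • A0, a.smul_mem _ hA0, _, by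
        rw [LinearMap.smul_apply, norm_smul]; simp [hAe], rfl⟩
    have hff : ⟪f, f⟫ = 1 := by rw [real_inner_self_eq_norm_sq, hf]; norm_num
    have hfe : ⟪f, e⟫ = 0 := by rw [← hCe]; exact skew_inner_self (hsk C hC) e
    have hef : ⟪e, f⟫ = 0 := by rw [real_inner_comm]; exact hfe
    have hcomm : ∀ B ∈ a, ∀ x, B (C x) = C (B x) := fun B hB x =>
      sub_eq_zero.1 (congrArg (fun g => g x) (hab B hB C hC))
    have hBf : ∀ B ∈ a, B f = - ⟪B e, f⟫ • e := by
      intro B hB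
      obtain ⟨l, hl⟩ := hj B hB C hC
      rw [hCe] at hl
      have : l = ⟪B f, e⟫ := by rw [hl, inner_smul_left, hee]; simp
      rw [hl, this, hsk B hB f e, real_inner_comm]
    have hCf : C f = - e := by
      rw [hBf C hC, hCe, hff]; simp
    have hBe : ∀ B ∈ a, B e = ⟪B e, f⟫ • f := by
      intro B hB
      have h1 : e = - C f := by rw [hCf]; simp
      have h2 : B e = - C (B f) := by
        nth_rw 1 [h1]; rw [map_neg, hcomm B hB]
      rw [hBf B hB, map_smul, hCe] at h2
      nth_rw 1 [h2]; simp
    have hperp : ∀ A ∈ a, ∀ x, A x ∈ U := by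
      intro A hA x
      rw [← Submodule.orthogonal_orthogonal U, Submodule.mem_orthogonal]
      intro u hu
      have := hsk A hA u x
      rw [hU A hA u hu] at this
      simp at this; linarith
    have hfU : f ∈ U := by rw [← hCe]; exact hperp C hC e
    have heU : e ∈ U := by
      have := hperp C hC f
      rw [hCf] at this; simpa using this
    let φ : (V →ₗ[ℝ] V) →ₗ[ℝ] ℝ := (innerₛₗ ℝ f) ∘ₗ (LinearMap.applyₗ e)
    have hφ : ∀ B, φ B = ⟪B e, f⟫ := by
      intro B; simp [φ, real_inner_comm]
    have r1 := finrank_map_add φ a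
    have r2 : Module.finrank ℝ (a.map φ) ≤ 1 := by
      simpa using Submodule.finrank_le (a.map φ)
    set a' := a ⊓ LinearMap.ker φ with ha'
    let ψ : V →ₗ[ℝ] (ℝ × ℝ) := (innerₛₗ ℝ e).prod (innerₛₗ ℝ f)
    have s1 := finrank_map_add ψ U
    have s2 : U.map ψ = ⊤ := by
      rw [eq_top_iff]
      rintro ⟨p, q⟩ _
      refine ⟨p • e + q • f, U.add_mem (U.smul_mem _ heU) (U.smul_mem _ hfU), ?_⟩
      simp [ψ, inner_add_right, inner_smul_right, hef, hfe, he, hf]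
    rw [s2] at s1
    simp only [finrank_top, Module.finrank_prod, Module.finrank_self] at s1
    set U' := U ⊓ LinearMap.ker ψ with hU'
    have hker : ∀ x, x - ⟪e, x⟫ • e - ⟪f, x⟫ • f ∈ LinearMap.ker ψ := by
      intro x
      rw [LinearMap.mem_ker]
      simp [ψ, inner_sub_right, inner_smul_right, hef, hfe, he, hf]
    -- vectors orthogonal to the subspace
    have hdec : ∀ x ∈ U'ᗮ, x - ⟪e, x⟫ • e - ⟪f, x⟫ • f ∈ Uᗮ := by
      intro x hx
      rw [Submodule.mem_orthogonal]
      intro u hu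
      have h1 := (Submodule.mem_orthogonal _ _).1 hx (u - ⟪e, u⟫ • e - ⟪f, u⟫ • f)
        ⟨U.sub_mem (U.sub_mem hu (U.smul_mem _ heU)) (U.smul_mem _ hfU), hker u⟩
      simp only [inner_sub_left, inner_sub_right, inner_smul_left, inner_smul_right] at h1 ⊢
      rw [real_inner_comm e u, real_inner_comm f u] 
      simp at h1 ⊢
      linarith
    by_cases h0 : a' = ⊥
    · rw [h0, finrank_bot] at r1
      have hU0 : U' = ⊥ := by
        rw [← Submodule.finrank_eq_zero (R := ℝ)]; omega
      refine ⟨e, f, he, hf, hef, ?_⟩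
      have : wd e f = C := by
        ext x
        have h1 := hU C hC _ (hdec x (by rw [hU0]; simp))
        simp only [map_sub, map_smul, hCe, hCf] at h1
        rw [wd_apply]
        rw [sub_sub, sub_eq_zero] at h1
        rw [h1]; simp [sub_eq_add_neg]
      rw [this]; exact hC
    · obtain ⟨e', f', h1, h2, h3, h4⟩ := ih U' a' (by omega) (fun A hA => hsk A hA.1)
        (fun A hA B hB => hab A hA.1 B hB.1) (by
          intro A hA x hx
          have h1 := hU A hA.1 _ (hdec x hx)
          have h2 : ⟪A e, f⟫ = 0 := by rw [← hφ]; exact LinearMap.mem_ker.1 hA.2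
          have h3 : A e = 0 := by rw [hBe A hA.1, h2]; simp
          have h4 : A f = 0 := by rw [hBf A hA.1, h2]; simp
          simpa [h3, h4] using h1) h0 (by omega)
      exact ⟨e', f', h1, h2, h3, h4.1⟩

/-- orthogonal complement of `g` in the skew endomorphisms -/
def perp (g : Submodule ℝ (V →ₗ[ℝ] V)) : Submodule ℝ (V →ₗ[ℝ] V) where
  carrier := {Z | IsSkew Z ∧ ∀ A ∈ g, ip Z A = 0}
  add_mem' := by
    rintro A B ⟨h1, h2⟩ ⟨h3, h4⟩
    exact ⟨(so V).add_mem h1 h3, fun C hC => by rw [map_add, LinearMap.add_apply, h2 C hC, h4 C hC, add_zero]⟩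
  zero_mem' := ⟨(so V).zero_mem, fun C _ => by simp⟩
  smul_mem' := by
    rintro c A ⟨h1, h2⟩
    exact ⟨(so V).smul_mem c h1, fun C hC => by rw [map_smul, LinearMap.smul_apply, h2 C hC, smul_zero]⟩

theorem mem_perp {g : Submodule ℝ (V →ₗ[ℝ] V)} {Z : V →ₗ[ℝ] V} :
    Z ∈ perp g ↔ IsSkew Z ∧ ∀ A ∈ g, ip Z A = 0 := Iff.rfl

theorem br_mem_perp {g : Submodule ℝ (V →ₗ[ℝ] V)} (hsk : ∀ A ∈ g, IsSkew A)
    (hgg : ∀ A ∈ g, ∀ B ∈ g, br A B ∈ g) {A Z : V →ₗ[ℝ] V} (hA : A ∈ g) (hZ : Z ∈ perp g) :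
    br A Z ∈ perp g := by
  refine ⟨br_skew (hsk A hA) hZ.1, fun B hB => ?_⟩
  rw [ip_inv (hsk A hA) hZ.1, hZ.2 _ (hgg A hA B hB), neg_zero]

theorem br_mem_perp' {g : Submodule ℝ (V →ₗ[ℝ] V)} (hsk : ∀ A ∈ g, IsSkew A)
    (hgg : ∀ A ∈ g, ∀ B ∈ g, br A B ∈ g) {A Z : V →ₗ[ℝ] V} (hA : A ∈ g) (hZ : Z ∈ perp g) :
    br Z A ∈ perp g := by
  rw [br_swap]; exact (perp g).neg_mem (br_mem_perp hsk hgg hA hZ)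

theorem lemR (g : Submodule ℝ (V →ₗ[ℝ] V)) (hsk : ∀ A ∈ g, IsSkew A)
    (hgg : ∀ A ∈ g, ∀ B ∈ g, br A B ∈ g)
    (hirr : ∀ W : Submodule ℝ V, (∀ A ∈ g, ∀ x ∈ W, A x ∈ W) → W = ⊥ ∨ W = ⊤)
    (e f : V) (he : ‖e‖ = 1) (hf : ‖f‖ = 1) (hef : ⟪e, f⟫ = 0) (hm : wd e f ∈ perp g)
    (hdec : ∀ x, ∃ x1 x2, x = x1 + x2 ∧ wd e x1 ∈ g ∧ wd e x2 ∈ perp g) : False := by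
  have hee : ⟪e, e⟫ = 1 := by rw [real_inner_self_eq_norm_sq, he]; norm_num
  have hff : ⟪f, f⟫ = 1 := by rw [real_inner_self_eq_norm_sq, hf]; norm_num
  have hAe : ∀ A ∈ g, wd e (A e) ∈ g := by
    intro A hA
    obtain ⟨y1, y2, h, h1, h2⟩ := hdec (A e)
    have h0 : wd e y2 = 0 := by
      apply ip_self_zero
      have e1 : y2 = A e - y1 := by rw [h]; abel
      have e2 : ip (wd e y2) (wd e y2) = ip (wd e y2) (wd e (A e)) - ip (wd e y2) (wd e y1) := by
        rw [← map_sub, ← wd_sub, ← e1]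
      rw [e2, h2.2 _ h1, ip_wd h2.1, wd_apply, hee]
      have h3 := h2.2 _ hA
      rw [ip_comm, ip_wd (hsk A hA)] at h3
      rw [inner_sub_left, inner_smul_left, inner_smul_left, real_inner_comm _ y2, h3,
        real_inner_comm _ e, skew_inner_self (hsk A hA)]
      simp
    rw [h, wd_add, h0, add_zero]; exact h1
  let U : Submodule ℝ V :=
    { carrier := {x | wd e x ∈ g}
      add_mem' := by intro a b ha hb; simp only [Set.mem_ofPred_eq] at *; rw [wd_add]; exact g.add_mem ha hb
      zero_mem' := by simp only [Set.mem_ofPred_eq]; rw [wd_zero]; exact g.zero_mem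
      smul_mem' := by intro c a ha; simp only [Set.mem_ofPred_eq] at *; rw [wd_smul]; exact g.smul_mem c ha }
  rcases hirr U (by
    intro A hA x hx
    have hx' : wd e x ∈ g := hx
    change wd e (A x) ∈ g
    have h1 := hgg A hA _ hx'
    have h2 := hAe A hA
    have h3 := hgg _ h2 _ hx'
    have hye : ⟪A e, e⟫ = 0 := skew_inner_self (hsk A hA) e
    rw [br_wd (hsk A hA)] at h1
    rw [br_wd (wd_skew _ _), wd_apply, wd_apply, hee, hye, wd_sub, wd_smul, wd_smul, wd_self] at h3
    simp only [one_smul, zero_smul, smul_zero, sub_zero] at h3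
    have h4 : wd (A e) x ∈ g := by
      have := g.sub_mem h3 (g.smul_mem ⟪e, x⟫ h2)
      simpa using this
    have := g.sub_mem h1 h4
    simpa using this) with h | h
  · have : e ∈ U := by change wd e e ∈ g; rw [wd_self]; exact g.zero_mem
    rw [h, Submodule.mem_bot] at this
    rw [this] at he; simp at he
  · have : f ∈ U := by rw [h]; trivial
    have h1 : wd e f ∈ g := this
    have h2 := hm.2 _ h1
    rw [ip_wd hm.1, wd_apply, hee, (real_inner_comm e f).trans hef] at h2
    simp [hf] at h2

theorem exists_proj (g : Submodule ℝ (V →ₗ[ℝ] V)) :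
    ∃ P : (V →ₗ[ℝ] V) →ₗ[ℝ] (V →ₗ[ℝ] V), (∀ Z, P Z ∈ g) ∧ ∀ Z, ∀ Y ∈ g, ip (Z - P Z) Y = 0 := by
  obtain ⟨X, hX, hon, hspan⟩ := exists_onb g
  refine ⟨∑ l, ((ip (X l)).smulRight (X l)), ?_, ?_⟩
  · intro Z
    simp only [LinearMap.sum_apply, LinearMap.smulRight_apply]
    exact Submodule.sum_mem _ fun l _ => g.smul_mem _ (hX l)
  · intro Z Y hY
    have h : ∀ k, ip (Z - (∑ l, ((ip (X l)).smulRight (X l))) Z) (X k) = 0 := by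
      intro k
      simp only [LinearMap.sum_apply, LinearMap.smulRight_apply]
      simp [hon, ip_comm Z]
    rw [hspan Y hY]
    simp only [map_sum, map_smul, h]; simp

section
variable {g : Submodule ℝ (V →ₗ[ℝ] V)} {P : (V →ₗ[ℝ] V) →ₗ[ℝ] (V →ₗ[ℝ] V)}

theorem proj_perp (hP1 : ∀ Z, P Z ∈ g) (hP2 : ∀ Z, ∀ Y ∈ g, ip (Z - P Z) Y = 0)
    {Z : V →ₗ[ℝ] V} (hZ : Z ∈ perp g) : P Z = 0 := by
  apply ip_self_zero
  have := hP2 Z _ (hP1 Z)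
  rw [map_sub, LinearMap.sub_apply, hZ.2 _ (hP1 Z)] at this
  linarith

theorem proj_mem (hP1 : ∀ Z, P Z ∈ g) (hP2 : ∀ Z, ∀ Y ∈ g, ip (Z - P Z) Y = 0)
    {Z : V →ₗ[ℝ] V} (hZ : Z ∈ g) : P Z = Z := by
  have := ip_self_zero (hP2 Z _ (g.sub_mem hZ (hP1 Z)))
  exact (sub_eq_zero.1 this).symm

theorem proj_sub (hsk : ∀ A ∈ g, IsSkew A) (hP1 : ∀ Z, P Z ∈ g)
    (hP2 : ∀ Z, ∀ Y ∈ g, ip (Z - P Z) Y = 0)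
    {Z : V →ₗ[ℝ] V} (hZ : IsSkew Z) : Z - P Z ∈ perp g :=
  ⟨(so V).sub_mem hZ (hsk _ (hP1 Z)), hP2 Z⟩

theorem proj_ip (hP1 : ∀ Z, P Z ∈ g) (hP2 : ∀ Z, ∀ Y ∈ g, ip (Z - P Z) Y = 0)
    (Y Z : V →ₗ[ℝ] V) (hY : Y ∈ g) : ip (P Z) Y = ip Z Y := by
  have := hP2 Z Y hY
  rw [map_sub, LinearMap.sub_apply] at this
  linarith

theorem proj_symm (hP1 : ∀ Z, P Z ∈ g) (hP2 : ∀ Z, ∀ Y ∈ g, ip (Z - P Z) Y = 0)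
    (Y Z : V →ₗ[ℝ] V) : ip (P Z) Y = ip Z (P Y) := by
  rw [← proj_ip hP1 hP2 (P Y) Z (hP1 Y), ip_comm (P Z) (P Y), proj_ip hP1 hP2 (P Z) Y (hP1 Z), ip_comm]

theorem proj_J (hsk : ∀ A ∈ g, IsSkew A) (hgg : ∀ A ∈ g, ∀ B ∈ g, br A B ∈ g)
    (hmm : ∀ A ∈ perp g, ∀ B ∈ perp g, br A B ∈ g)
    (hP1 : ∀ Z, P Z ∈ g) (hP2 : ∀ Z, ∀ Y ∈ g, ip (Z - P Z) Y = 0)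
    {J Z : V →ₗ[ℝ] V} (hJ : J ∈ perp g) (hZ : IsSkew Z) : P (br J Z) = br J Z - br J (P Z) := by
  have h1 : br J Z = br J (Z - P Z) + br J (P Z) := by rw [br_sub]; abel
  have h2 := proj_mem hP1 hP2 (hmm J hJ _ (proj_sub hsk hP1 hP2 hZ))
  have h3 := proj_perp hP1 hP2 (br_mem_perp' hsk hgg (hP1 Z) hJ)
  rw [h1, map_add, h2, h3]; abel

theorem J_e {e f y : V} (he : ‖e‖ = 1) (hef : ⟪e, f⟫ = 0)
    (h1 : ⟪e, y⟫ = 0) (h2 : ⟪f, y⟫ = 0) : br (wd e f) (wd e y) = wd f y := by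
  have hfe : ⟪f, e⟫ = 0 := by rw [real_inner_comm]; exact hef
  rw [br_wd (wd_skew _ _), wd_apply, wd_apply, h1, h2, hfe, real_inner_self_eq_norm_sq, he]
  simp [wd_zero]

theorem J_f {e f y : V} (hf : ‖f‖ = 1) (hef : ⟪e, f⟫ = 0)
    (h1 : ⟪e, y⟫ = 0) (h2 : ⟪f, y⟫ = 0) : br (wd e f) (wd f y) = - wd e y := by
  rw [br_wd (wd_skew _ _), wd_apply, wd_apply, h1, h2, hef, real_inner_self_eq_norm_sq, hf]
  have := smul_wd (-1) e y
  simp [wd_zero] at this ⊢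
  exact this

theorem proj_E (hsk : ∀ A ∈ g, IsSkew A) (hgg : ∀ A ∈ g, ∀ B ∈ g, br A B ∈ g)
    (hmm : ∀ A ∈ perp g, ∀ B ∈ perp g, br A B ∈ g)
    (hP1 : ∀ Z, P Z ∈ g) (hP2 : ∀ Z, ∀ Y ∈ g, ip (Z - P Z) Y = 0)
    {e f : V} (he : ‖e‖ = 1) (hf : ‖f‖ = 1) (hef : ⟪e, f⟫ = 0) (hm : wd e f ∈ perp g) (x : V) :
    P (wd e x) = wd e (P (wd e x) e) + wd f (P (wd e x) f) ∧
    ⟪e, P (wd e x) e⟫ = 0 ∧ ⟪f, P (wd e x) e⟫ = 0 ∧ ⟪e, P (wd e x) f⟫ = 0 ∧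
    ⟪f, P (wd e x) f⟫ = 0 := by
  have hfe : ⟪f, e⟫ = 0 := by rw [real_inner_comm]; exact hef
  have hee : ⟪e, e⟫ = 1 := by rw [real_inner_self_eq_norm_sq, he]; norm_num
  have hff : ⟪f, f⟫ = 1 := by rw [real_inner_self_eq_norm_sq, hf]; norm_num
  set A := P (wd e x) with hA
  have hAs : IsSkew A := hsk _ (hP1 _)
  have i1 : ⟪e, A e⟫ = 0 := by rw [real_inner_comm]; exact skew_inner_self hAs e
  have i4 : ⟪f, A f⟫ = 0 := by rw [real_inner_comm]; exact skew_inner_self hAs f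
  have i2 : ⟪f, A e⟫ = 0 := by
    rw [real_inner_comm, ← ip_wd hAs, ip_comm]; exact hm.2 _ (hP1 _)
  have i3 : ⟪e, A f⟫ = 0 := by
    have := hAs e f
    rw [real_inner_comm, i2] at this; linarith
  refine ⟨?_, i1, i2, i3, i4⟩
  set x0 := x - ⟪e, x⟫ • e - ⟪f, x⟫ • f with hx0
  have j1 : ⟪e, x0⟫ = 0 := by
    rw [hx0]; simp [inner_sub_right, inner_smul_right, he, hef]
  have j2 : ⟪f, x0⟫ = 0 := by
    rw [hx0]; simp [inner_sub_right, inner_smul_right, hf, hfe]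
  have hA' : A = P (wd e x0) := by
    rw [hx0, wd_sub, wd_sub, wd_smul, wd_smul, wd_self, map_sub, map_sub, map_smul, map_smul,
      proj_perp hP1 hP2 hm]
    simp [hA]
  have k1 := proj_J hsk hgg hmm hP1 hP2 hm (wd_skew e x0)
  have k2 := proj_J hsk hgg hmm hP1 hP2 hm (wd_skew f x0)
  rw [J_e he hef j1 j2] at k1
  rw [J_f hf hef j1 j2, k1, map_neg, br_sub, J_f hf hef j1 j2, ← hA'] at k2
  have k3 : A = - br (wd e f) (br (wd e f) A) := by
    rw [← neg_inj, k2]; simp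
  have k4 : br (wd e f) A = wd f (A e) - wd e (A f) := by
    rw [br_swap, br_wd hAs, wd_swap (A e) f]; abel
  rw [k4, br_sub, J_e he hef i3 i4, J_f hf hef i1 i2] at k3
  rw [sub_eq_add_neg, neg_add, neg_neg, neg_neg] at k3
  exact k3

end

/-- second half of the rank two lemma -/
theorem rank_two_aux (g : Submodule ℝ (V →ₗ[ℝ] V)) (hsk : ∀ A ∈ g, IsSkew A)
    (hgg : ∀ A ∈ g, ∀ B ∈ g, br A B ∈ g)
    (hmm : ∀ A ∈ perp g, ∀ B ∈ perp g, br A B ∈ g)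
    (hirr : ∀ W : Submodule ℝ V, (∀ A ∈ g, ∀ x ∈ W, A x ∈ W) → W = ⊥ ∨ W = ⊤)
    (e f w : V) (he : ‖e‖ = 1) (hf : ‖f‖ = 1) (hef : ⟪e, f⟫ = 0) (hm : wd e f ∈ perp g)
    (hw0 : w ≠ 0) (hew : ⟪e, w⟫ = 0) (hfw : ⟪f, w⟫ = 0) (hg : wd e w ∈ g) : False := by
  have hfe : ⟪f, e⟫ = 0 := by rw [real_inner_comm]; exact hef
  have hwe : ⟪w, e⟫ = 0 := by rw [real_inner_comm]; exact hew
  have hwf : ⟪w, f⟫ = 0 := by rw [real_inner_comm]; exact hfw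
  have hee : ⟪e, e⟫ = 1 := by rw [real_inner_self_eq_norm_sq, he]; norm_num
  have hff : ⟪f, f⟫ = 1 := by rw [real_inner_self_eq_norm_sq, hf]; norm_num
  obtain ⟨P, hP1, hP2⟩ := exists_proj g
  have split : ∀ u u', ⟪e, u⟫ = 0 → ⟪f, u⟫ = 0 → ⟪e, u'⟫ = 0 → ⟪f, u'⟫ = 0 →
      wd e u + wd f u' ∈ g → wd e u ∈ g := by
    intro u u' h1 h2 h3 h4 h
    have k := hgg _ hg _ h
    rw [br_add, br_wd (wd_skew _ _), br_wd (wd_skew _ _), wd_apply, wd_apply, wd_apply, wd_apply,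
      hee, hwe, h1, hef, hwf, h3] at k
    simp only [one_smul, zero_smul, sub_zero, zero_sub] at k
    have k' : wd w u + ⟪w, u'⟫ • wd e f ∈ g := by
      have e1 : wd w u + wd e (-(⟪w, u⟫ • e)) + (wd 0 u' + wd f (-(⟪w, u'⟫ • e)))
          = wd w u + ⟪w, u'⟫ • wd e f := by
        rw [← neg_smul, ← neg_smul, wd_smul, wd_smul, wd_self, wd_swap f e, wd_swap 0, wd_zero]
        simp
      rw [← e1]; exact k
    have z := hm.2 _ k'
    have z2 : ⟪w, u'⟫ = 0 := by
      rw [map_add, map_smul, ip_wd hm.1, ip_wd hm.1, wd_apply, wd_apply, hew, hfw, hee, hfe] at z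
      simpa [hf] using z
    rw [z2, zero_smul, add_zero] at k'
    have k2 := hgg _ hg _ k'
    rw [br_wd (wd_skew _ _), wd_apply, wd_apply, hew, h1, zero_smul, zero_sub, zero_sub,
      ← neg_smul, ← neg_smul, smul_wd, wd_smul, wd_swap w e] at k2
    have hww : ⟪w, w⟫ ≠ 0 := by simpa using hw0
    have k3 : ⟪w, w⟫ • wd e u ∈ g := by
      have := g.sub_mem (g.smul_mem ⟪w, u⟫ hg) k2
      simpa using this
    have := g.smul_mem (⟪w, w⟫)⁻¹ k3
    rwa [smul_smul, inv_mul_cancel₀ hww, one_smul] at this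
  apply lemR g hsk hgg hirr e f he hf hef hm
  intro x
  obtain ⟨h0, h1, h2, h3, h4⟩ := proj_E hsk hgg hmm hP1 hP2 he hf hef hm x
  have hPx := hP1 (wd e x)
  have hPs := hsk _ hPx
  set a := P (wd e x) e with ha
  set b := P (wd e x) f with hb
  have m1 : wd e a ∈ g := split a b h1 h2 h3 h4 (by rw [← h0]; exact hPx)
  have m2 : wd f b ∈ g := by
    rw [h0] at hPx
    have := g.sub_mem hPx m1
    simpa using this
  have hb0 : b = 0 := by
    have := proj_ip hP1 hP2 _ (wd e x) m2
    rw [ip_wd hPs, ip_wd (wd_skew _ _), ← hb, wd_apply, hef, zero_smul, zero_sub, inner_neg_left,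
      inner_smul_left, h3] at this
    simpa using this
  refine ⟨a, x - a, by abel, m1, ?_⟩
  have hd := proj_sub hsk hP1 hP2 (wd_skew e x)
  rw [h0, hb0, wd_zero, add_zero, ← wd_sub] at hd
  exact hd

theorem rank_two (g : Submodule ℝ (V →ₗ[ℝ] V)) (hsk : ∀ A ∈ g, IsSkew A)
    (hgg : ∀ A ∈ g, ∀ B ∈ g, br A B ∈ g)
    (hmm : ∀ A ∈ perp g, ∀ B ∈ perp g, br A B ∈ g)
    (hirr : ∀ W : Submodule ℝ V, (∀ A ∈ g, ∀ x ∈ W, A x ∈ W) → W = ⊥ ∨ W = ⊤)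
    (hn : 4 < Module.finrank ℝ V)
    (e f : V) (he : ‖e‖ = 1) (hf : ‖f‖ = 1) (hef : ⟪e, f⟫ = 0) (hm : wd e f ∈ perp g) : False := by
  have hfe : ⟪f, e⟫ = 0 := by rw [real_inner_comm]; exact hef
  have hee : ⟪e, e⟫ = 1 := by rw [real_inner_self_eq_norm_sq, he]; norm_num
  have hff : ⟪f, f⟫ = 1 := by rw [real_inner_self_eq_norm_sq, hf]; norm_num
  obtain ⟨P, hP1, hP2⟩ := exists_proj g
  have hE := proj_E hsk hgg hmm hP1 hP2 he hf hef hm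
  let a : V →ₗ[ℝ] V :=
    { toFun := fun x => P (wd e x) e
      map_add' := fun x y => by rw [wd_add, map_add]; rfl
      map_smul' := fun c x => by rw [wd_smul, map_smul]; rfl }
  let b : V →ₗ[ℝ] V :=
    { toFun := fun x => P (wd e x) f
      map_add' := fun x y => by rw [wd_add, map_add]; rfl
      map_smul' := fun c x => by rw [wd_smul, map_smul]; rfl }
  have ha : ∀ x, P (wd e x) e = a x := fun x => rfl
  have hb : ∀ x, P (wd e x) f = b x := fun x => rfl
  simp only [ha, hb] at hE
  let W : Submodule ℝ V := LinearMap.ker (innerₛₗ ℝ e) ⊓ LinearMap.ker (innerₛₗ ℝ f)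
  let q : V → V := fun x => x - ⟪e, x⟫ • e - ⟪f, x⟫ • f
  have q1 : ∀ x, ⟪e, q x⟫ = 0 := by
    intro x; simp [q, inner_sub_right, inner_smul_right, he, hef]
  have q2 : ∀ x, ⟪f, q x⟫ = 0 := by
    intro x; simp [q, inner_sub_right, inner_smul_right, hf, hfe]
  have qP : ∀ x, P (wd e (q x)) = P (wd e x) := by
    intro x
    simp only [q]
    rw [wd_sub, wd_sub, wd_smul, wd_smul, wd_self, map_sub, map_sub, map_smul, map_smul,
      proj_perp hP1 hP2 hm]
    simp
  have qa : ∀ x, a (q x) = a x := fun x => by rw [← ha, qP]; rfl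
  have qb : ∀ x, b (q x) = b x := fun x => by rw [← hb, qP]; rfl
  have qid : ∀ x, ⟪e, x⟫ = 0 → ⟪f, x⟫ = 0 → q x = x := by
    intro x h1 h2; simp [q, h1, h2]
  have qsm : ∀ (c : ℝ) x, q (c • x) = c • q x := by
    intro c x; simp [q, inner_smul_right, smul_sub, smul_smul]
  have Psk : ∀ Z, IsSkew (P Z) := fun Z => hsk _ (hP1 Z)
  have asym : a.IsSymmetric := by
    intro x y
    rw [← ha, ← ha, ← ip_wd (Psk _), proj_symm hP1 hP2, ip_comm, ip_wd (Psk _), real_inner_comm]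
  have PJ : ∀ y, ⟪e, y⟫ = 0 → ⟪f, y⟫ = 0 → P (wd f y) = wd f y - wd f (a y) + wd e (b y) := by
    intro y h1 h2
    have := proj_J hsk hgg hmm hP1 hP2 hm (wd_skew e y)
    obtain ⟨k0, k1, k2, k3, k4⟩ := hE y
    rw [J_e he hef h1 h2, k0, br_add, J_e he hef k1 k2, J_f hf hef k3 k4] at this
    rw [this]; abel
  have bsym' : ∀ x y, ⟪e, x⟫ = 0 → ⟪f, x⟫ = 0 → ⟪e, y⟫ = 0 → ⟪f, y⟫ = 0 → ⟪b x, y⟫ = ⟪x, b y⟫ := by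
    intro x y h1 h2 h3 h4
    rw [← hb, ← ip_wd (Psk _), proj_symm hP1 hP2, PJ y h3 h4, map_add, map_sub, ip_wd (wd_skew _ _),
      ip_wd (wd_skew _ _), ip_wd (wd_skew _ _), wd_apply, wd_apply, hef, hee,
      real_inner_comm f x, h2, real_inner_comm e x, h1]
    simp
  have qort : ∀ x y, ⟪e, y⟫ = 0 → ⟪f, y⟫ = 0 → ⟪q x, y⟫ = ⟪x, y⟫ := by
    intro x y h1 h2
    simp [q, inner_sub_left, inner_smul_left, h1, h2]
  have bsym : b.IsSymmetric := by
    intro x y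
    obtain ⟨_, _, _, k3, k4⟩ := hE x
    obtain ⟨_, _, _, l3, l4⟩ := hE y
    have := bsym' (q x) (q y) (q1 x) (q2 x) (q1 y) (q2 y)
    rw [qb, qb, qort _ _ l3 l4, real_inner_comm, qort _ _ k3 k4, real_inner_comm] at this
    exact this
  have hcomm : Commute a b := by
    change a * b = b * a
    ext x
    change a (b x) = b (a x)
    obtain ⟨k0, k1, k2, k3, k4⟩ := hE x
    have h1 := proj_mem hP1 hP2 (hP1 (wd e x))
    rw [k0, map_add, PJ _ k3 k4] at h1
    have h2 := congrArg (fun Z => Z f) h1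
    simp only [LinearMap.add_apply, LinearMap.sub_apply, hb, wd_apply, hff, hef] at h2
    obtain ⟨_, m1, m2, m3, m4⟩ := hE (b x)
    rw [real_inner_comm f (b x), k4, real_inner_comm f (a x), k2, real_inner_comm f (a (b x)), m2,
      real_inner_comm f (b (b x)), m4] at h2
    simp at h2
    have h3 : b (a x) - a (b x) = 0 := by
      rw [← sub_eq_zero] at h2
      rw [← h2]; abel
    exact (sub_eq_zero.1 h3).symm
  -- joint eigenvector
  have hex : ∃ s t : ℝ, ∃ v, a v = s • v ∧ b v = t • v ∧ q v ≠ 0 := by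
    by_contra hcon
    push Not at hcon
    have htop := LinearMap.IsSymmetric.iSup_iSup_eigenspace_inf_eigenspace_eq_top_of_commute
      asym bsym hcomm
    have hq : ∀ x, q x = 0 := by
      let ql : V →ₗ[ℝ] V :=
        { toFun := q
          map_add' := fun x y => by simp only [q, inner_add_right, add_smul]; abel
          map_smul' := qsm }
      have : (⊤ : Submodule ℝ V) ≤ LinearMap.ker ql := by
        rw [← htop]
        refine iSup_le fun s => iSup_le fun t v hv => ?_
        exact hcon _ _ v (Module.End.mem_eigenspace_iff.1 hv.1) (Module.End.mem_eigenspace_iff.1 hv.2)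
      intro x
      exact this (Submodule.mem_top (x := x))
    obtain ⟨u, hu, hu2⟩ := exists_orth ![e, f] (by omega)
    have h1 := hq u
    rw [qid u (by rw [real_inner_comm]; exact hu2 0) (by rw [real_inner_comm]; exact hu2 1)] at h1
    rw [h1] at hu; simp at hu
  obtain ⟨s, t, v, hav, hbv, hv⟩ := hex
  set w := q v with hw
  have haw : a w = s • w := by
    obtain ⟨_, k1, k2, _, _⟩ := hE v
    rw [hw, qa, ← qsm, ← hav, qid _ k1 k2]
  have hbw : b w = t • w := by
    obtain ⟨_, _, _, k1, k2⟩ := hE v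
    rw [hw, qb, ← qsm, ← hbv, qid _ k1 k2]
  have hew := q1 v
  have hfw := q2 v
  rw [← hw] at hew hfw
  have hPw : P (wd e w) = wd (s • e + t • f) w := by
    rw [(hE w).1, haw, hbw, wd_smul, wd_smul, add_wd, smul_wd, smul_wd]
  by_cases hs : s = 0
  · have hz : P (wd e w) = 0 := by
      apply ip_self_zero
      rw [proj_ip hP1 hP2 _ _ (hP1 _), ip_comm, ip_wd (Psk _), ha, haw, hs]; simp
    have hmw : wd e w ∈ perp g := by
      have := proj_sub hsk hP1 hP2 (wd_skew e w)
      rwa [hz, sub_zero] at this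
    have hgw := hmm _ hm _ hmw
    rw [J_e he hef hew hfw] at hgw
    refine rank_two_aux g hsk hgg hmm hirr f (-e) w hf (by simpa using he) (by simpa using hfe) ?_ hv
      hfw (by simpa using hew) hgw
    have : wd f (-e) = wd e f := by
      have := wd_smul (-1) f e
      rw [wd_swap e f]; simpa using this
    rw [this]; exact hm
  · set r := Real.sqrt (s ^ 2 + t ^ 2) with hr
    have hpos : 0 < s ^ 2 + t ^ 2 := by positivity
    have hr2 : r ^ 2 = s ^ 2 + t ^ 2 := Real.sq_sqrt hpos.le
    have hr0 : r ≠ 0 := (Real.sqrt_pos.2 hpos).ne'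
    have hnorm : ∀ x y : ℝ, x ^ 2 + y ^ 2 = 1 → ‖x • e + y • f‖ = 1 := by
      intro x y h
      have : ‖x • e + y • f‖ ^ 2 = 1 := by
        rw [← real_inner_self_eq_norm_sq]
        simp only [inner_add_left, inner_add_right, inner_smul_left, inner_smul_right, hee, hff, hef, hfe]
        simp; linarith
      have h0 := norm_nonneg (x • e + y • f)
      nlinarith
    have h1 : (s / r) ^ 2 + (t / r) ^ 2 = 1 := by field_simp; linarith
    refine rank_two_aux g hsk hgg hmm hirr ((s / r) • e + (t / r) • f) ((- (t / r)) • e + (s / r) • f) w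
      (hnorm _ _ h1) (hnorm _ _ (by rw [neg_sq]; linarith)) ?_ ?_ hv ?_ ?_ ?_
    · simp only [inner_add_left, inner_add_right, inner_smul_left, inner_smul_right, hee, hff, hef, hfe]
      simp; ring
    · have : wd ((s / r) • e + (t / r) • f) ((- (t / r)) • e + (s / r) • f) = wd e f := by
        simp only [add_wd, wd_add, smul_wd, wd_smul, wd_self, wd_swap f e]
        have : ((s / r) ^ 2 + (t / r) ^ 2) • wd e f = wd e f := by rw [h1, one_smul]
        refine Eq.trans ?_ this; simp only [smul_zero, smul_smul, smul_neg]; module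
      rw [this]; exact hm
    · simp only [inner_add_left, inner_smul_left, hew, hfw]; simp
    · simp only [inner_add_left, inner_smul_left, hew, hfw]; simp
    · have h2 := g.smul_mem r⁻¹ (hP1 (wd e w))
      rw [hPw, ← smul_wd, smul_add, smul_smul, smul_smul] at h2
      rwa [div_eq_inv_mul, div_eq_inv_mul]

theorem cas_expand {ι : Type} [Fintype ι] (β : ι → (V →ₗ[ℝ] V)) (Z : V →ₗ[ℝ] V) :
    ∑ k, br (β k) (br (β k) Z) =
      (∑ k, β k * β k) * Z + Z * (∑ k, β k * β k) - (2:ℝ) • ∑ k, β k * Z * β k := by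
  rw [Finset.sum_mul, Finset.mul_sum, Finset.smul_sum, ← Finset.sum_add_distrib,
    ← Finset.sum_sub_distrib]
  apply Finset.sum_congr rfl
  intro k _
  simp only [br]
  rw [two_smul]; noncomm_ring

theorem full_sandwich {ι : Type} [Fintype ι] (β : ι → (V →ₗ[ℝ] V)) (hsk : ∀ k, IsSkew (β k))
    (hpar : ∀ Z, IsSkew Z → Z = ∑ k, ip Z (β k) • β k) (Z : V →ₗ[ℝ] V) (x : V) :
    (∑ k, β k * Z * β k) x = ∑ j, (⟪x, Z (stdOrthonormalBasis ℝ V j)⟫ • stdOrthonormalBasis ℝ V j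
      - ⟪stdOrthonormalBasis ℝ V j, Z (stdOrthonormalBasis ℝ V j)⟫ • x) := by
  set E := stdOrthonormalBasis ℝ V
  have h1 : ∀ u v, ∑ k, ⟪β k x, u⟫ • β k v = ⟪x, v⟫ • u - ⟪u, v⟫ • x := by
    intro u v
    rw [← wd_apply, hpar _ (wd_skew x u), LinearMap.sum_apply]
    apply Finset.sum_congr rfl
    intro k _
    rw [LinearMap.smul_apply, ip_comm, ip_wd (hsk k)]
  rw [LinearMap.sum_apply]
  simp only [← h1]
  rw [Finset.sum_comm]
  apply Finset.sum_congr rfl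
  intro k _
  change β k (Z (β k x)) = _
  conv_lhs => rw [← E.sum_repr (β k x)]
  simp only [map_sum, map_smul, E.repr_apply_apply]
  apply Finset.sum_congr rfl
  intro j _
  rw [real_inner_comm]

theorem full_sq {ι : Type} [Fintype ι] (β : ι → (V →ₗ[ℝ] V)) (hsk : ∀ k, IsSkew (β k))
    (hpar : ∀ Z, IsSkew Z → Z = ∑ k, ip Z (β k) • β k) :
    (∑ k, β k * β k) = (-((Module.finrank ℝ V : ℝ) - 1)) • (1 : V →ₗ[ℝ] V) := by
  ext x
  have := full_sandwich β hsk hpar 1 x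
  simp only [mul_one] at this
  rw [this]
  simp only [Module.End.one_apply, Finset.sum_sub_distrib, LinearMap.smul_apply]
  have h2 : ∑ j, ⟪x, stdOrthonormalBasis ℝ V j⟫ • stdOrthonormalBasis ℝ V j = x := by
    conv_rhs => rw [← (stdOrthonormalBasis ℝ V).sum_repr x]
    simp only [(stdOrthonormalBasis ℝ V).repr_apply_apply, real_inner_comm]
  rw [h2]
  simp
  rw [← Nat.cast_smul_eq_nsmul ℝ]
  module

theorem full_cas {ι : Type} [Fintype ι] (β : ι → (V →ₗ[ℝ] V)) (hsk : ∀ k, IsSkew (β k))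
    (hpar : ∀ Z, IsSkew Z → Z = ∑ k, ip Z (β k) • β k) (Z : V →ₗ[ℝ] V) (hZ : IsSkew Z) :
    ∑ k, br (β k) (br (β k) Z) = (-(2 * ((Module.finrank ℝ V : ℝ) - 2))) • Z := by
  have h1 : ∑ k, β k * Z * β k = - Z := by
    ext x
    rw [full_sandwich β hsk hpar Z x]
    have : ∀ j, ⟪x, Z (stdOrthonormalBasis ℝ V j)⟫ • stdOrthonormalBasis ℝ V j
      - ⟪stdOrthonormalBasis ℝ V j, Z (stdOrthonormalBasis ℝ V j)⟫ • x
      = - (⟪stdOrthonormalBasis ℝ V j, Z x⟫ • stdOrthonormalBasis ℝ V j) := by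
      intro j
      rw [real_inner_comm _ (stdOrthonormalBasis ℝ V j), skew_inner_self hZ, real_inner_comm _ x, hZ]
      simp
    simp only [this, Finset.sum_neg_distrib, LinearMap.neg_apply]
    congr 1
    conv_rhs => rw [← (stdOrthonormalBasis ℝ V).sum_repr (Z x)]
    simp only [(stdOrthonormalBasis ℝ V).repr_apply_apply]
  rw [cas_expand, h1, full_sq β hsk hpar]
  simp only [smul_mul_assoc, mul_smul_comm, one_mul, mul_one]
  module

theorem trace_sq {ι : Type} [Fintype ι] (β : ι → (V →ₗ[ℝ] V)) (hsk : ∀ k, IsSkew (β k))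
    (hon : ∀ k, ip (β k) (β k) = 1) (c : ℝ) (h : ∑ k, β k * β k = (-c) • (1 : V →ₗ[ℝ] V)) :
    c * Module.finrank ℝ V = 2 * Fintype.card ι := by
  have h1 := congrArg (LinearMap.trace ℝ V) h
  rw [map_sum, map_smul, LinearMap.trace_one] at h1
  have h2 : ∀ k, LinearMap.trace ℝ V (β k * β k) = -2 := by
    intro k
    have := ip_trace (hsk k) (β k)
    rw [hon k] at this; linarith
  simp only [h2] at h1
  simp at h1
  linarith

theorem cas_scalar (g : Submodule ℝ (V →ₗ[ℝ] V)) (hsk : ∀ A ∈ g, IsSkew A)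
    (hgg : ∀ A ∈ g, ∀ B ∈ g, br A B ∈ g)
    (hirr : ∀ W : Submodule ℝ V, (∀ A ∈ g, ∀ x ∈ W, A x ∈ W) → W = ⊥ ∨ W = ⊤)
    (hn : 4 < Module.finrank ℝ V) {N : ℕ} (α : Fin N → (V →ₗ[ℝ] V)) (hα : ∀ k, α k ∈ g)
    (hpar : ∀ A ∈ g, A = ∑ k, ip A (α k) • α k) :
    ∃ c : ℝ, ∑ k, α k * α k = (-c) • (1 : V →ₗ[ℝ] V) := by
  have hαs := fun k => hsk _ (hα k)
  set C := ∑ k, α k * α k with hC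
  have hcomm : ∀ B ∈ g, B * C = C * B := by
    intro B hB
    have h1 : B * C - C * B = ∑ k, (br B (α k) * α k + α k * br B (α k)) := by
      rw [hC, Finset.mul_sum, Finset.sum_mul, ← Finset.sum_sub_distrib]
      apply Finset.sum_congr rfl
      intro k _
      simp only [br]; noncomm_ring
    have h2 : ∀ k, br B (α k) = ∑ l, ip (br B (α k)) (α l) • α l := fun k => hpar _ (hgg _ hB _ (hα k))
    have h3 : ∀ k l, ip (br B (α k)) (α l) = - ip (br B (α l)) (α k) := by
      intro k l
      rw [ip_inv (hsk B hB) (hαs k), ip_comm]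
    have h4 : ∑ k, br B (α k) * α k = ∑ k, ∑ l, ip (br B (α k)) (α l) • (α l * α k) := by
      apply Finset.sum_congr rfl
      intro k _
      conv_lhs => rw [h2 k]
      rw [Finset.sum_mul]
      simp only [smul_mul_assoc]
    have h5 : ∑ k, α k * br B (α k) = ∑ k, ∑ l, ip (br B (α k)) (α l) • (α k * α l) := by
      apply Finset.sum_congr rfl
      intro k _
      conv_lhs => rw [h2 k]
      rw [Finset.mul_sum]
      simp only [mul_smul_comm]
    rw [Finset.sum_add_distrib, h4, h5, Finset.sum_comm, ← Finset.sum_add_distrib] at h1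
    rw [← sub_eq_zero, h1]
    apply Finset.sum_eq_zero
    intro k _
    rw [← Finset.sum_add_distrib]
    apply Finset.sum_eq_zero
    intro l _
    rw [h3 l k]; simp
  have hsym : C.IsSymmetric := by
    intro x y
    rw [hC, LinearMap.sum_apply, LinearMap.sum_apply, sum_inner, inner_sum]
    apply Finset.sum_congr rfl
    intro k _
    change ⟪α k (α k x), y⟫ = ⟪x, α k (α k y)⟫
    rw [hαs k, hαs k]; simp
  have : Nontrivial V := Module.nontrivial_of_finrank_pos (R := ℝ) (by omega)
  obtain ⟨μ, hμ⟩ : ∃ μ : ℝ, Module.End.HasEigenvalue C μ := ⟨_, hsym.hasEigenvalue_iSup_of_finiteDimensional⟩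
  refine ⟨-μ, ?_⟩
  rcases hirr (Module.End.eigenspace C μ) (by
    intro A hA x hx
    rw [Module.End.mem_eigenspace_iff] at *
    have := congrArg (fun f => f x) (hcomm A hA)
    change A (C x) = C (A x) at this
    rw [← this, hx, map_smul]) with h | h
  · exact absurd h hμ
  · ext x
    have : x ∈ Module.End.eigenspace C μ := by rw [h]; trivial
    rw [Module.End.mem_eigenspace_iff] at this
    simpa using this

theorem lstar_k {F A : V →ₗ[ℝ] V} (hF : IsSkew F) (hA : IsSkew A) (X Y : V) :
    (∑ i, ∑ j ∈ Finset.Ioi i,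
        ⟪F (stdOrthonormalBasis ℝ V i), stdOrthonormalBasis ℝ V j⟫ *
          wedgeSelf A (stdOrthonormalBasis ℝ V i) (stdOrthonormalBasis ℝ V j) X Y)
      = 2 * (ip F A * ⟪A X, Y⟫ + ⟪A (F (A X)), Y⟫) := by
  set E := stdOrthonormalBasis ℝ V with hE
  have hdiag : ∀ i, ⟪F (E i), E i⟫ = 0 := fun i => skew_inner_self hF _
  rw [sum_Ioi_symm]
  · have h1 : ∑ i, ∑ j, ⟪F (E i), E j⟫ * ⟪A (E i), E j⟫ = 2 * ip F A := by
      rw [ip_def, ← mul_assoc, mul_one_div_cancel two_ne_zero, one_mul]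
      apply Finset.sum_congr rfl
      intro i _
      rw [← E.sum_inner_mul_inner (F _) (A _)]
      simp only [real_inner_comm (A _)]
      rfl
    have h2 : ∀ P Q : V, ∑ i, ∑ j, ⟪F (E i), E j⟫ * (⟪A (E i), P⟫ * ⟪A (E j), Q⟫) = - ⟪A (F (A P)), Q⟫ := by
      intro P Q
      have e1 : ∀ i, ∑ j, ⟪F (E i), E j⟫ * (⟪A (E i), P⟫ * ⟪A (E j), Q⟫)
          = - (⟪F (A Q), E i⟫ * ⟪E i, A P⟫) := by
        intro i
        have : ∑ j, ⟪F (E i), E j⟫ * (⟪A (E i), P⟫ * ⟪A (E j), Q⟫)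
          = - ⟪A (E i), P⟫ * ∑ j, ⟪F (E i), E j⟫ * ⟪E j, A Q⟫ := by
          rw [Finset.mul_sum]
          apply Finset.sum_congr rfl
          intro j _
          rw [hA (E j) Q]; ring
        rw [this, E.sum_inner_mul_inner, hA (E i) P, hF (E i), real_inner_comm (F (A Q))]; ring
      simp only [e1, Finset.sum_neg_distrib]
      rw [E.sum_inner_mul_inner, hF, hA, real_inner_comm, hA (F (A P)) Q, ← hA]
      ring
    have h3 : ∀ i j, ⟪F (E i), E j⟫ * wedgeSelf A (E i) (E j) X Y =
        2 * ⟪A X, Y⟫ * (⟪F (E i), E j⟫ * ⟪A (E i), E j⟫)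
        - 2 * (⟪F (E i), E j⟫ * (⟪A (E i), X⟫ * ⟪A (E j), Y⟫))
        + 2 * (⟪F (E i), E j⟫ * (⟪A (E i), Y⟫ * ⟪A (E j), X⟫)) := by
      intro i j; unfold wedgeSelf; ring
    simp only [h3, Finset.sum_add_distrib, Finset.sum_sub_distrib, ← Finset.mul_sum, h1, h2]
    have h4 : ⟪A (F (A Y)), X⟫ = - ⟪A (F (A X)), Y⟫ := by
      rw [hA, hF, hA, real_inner_comm]; ring
    rw [h4]; ring
  · intro i j
    unfold wedgeSelf
    rw [hF (E i), hA (E i) (E j), real_inner_comm, real_inner_comm (A (E j)) (E i)]; ring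
  · intro i; rw [hdiag]; simp

theorem sandwich_ip {ι : Type} [Fintype ι] (β : ι → (V →ₗ[ℝ] V)) (hsk : ∀ k, IsSkew (β k))
    {Z : V →ₗ[ℝ] V} (hZ : IsSkew Z) (Y : V →ₗ[ℝ] V) :
    ip (∑ k, br (β k) (br (β k) Z)) Y = - ∑ k, ip (br (β k) Z) (br (β k) Y) := by
  rw [map_sum, LinearMap.sum_apply, ← Finset.sum_neg_distrib]
  apply Finset.sum_congr rfl
  intro k _
  rw [ip_inv (hsk k) (br_skew (hsk k) hZ)]

theorem core (g : Submodule ℝ (V →ₗ[ℝ] V)) (hsk : ∀ A ∈ g, IsSkew A)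
    (hgg : ∀ A ∈ g, ∀ B ∈ g, br A B ∈ g)
    (hproper : ∃ A : V →ₗ[ℝ] V, IsSkew A ∧ A ∉ g)
    (hirr : ∀ W : Submodule ℝ V, (∀ A ∈ g, ∀ x ∈ W, A x ∈ W) → W = ⊥ ∨ W = ⊤)
    (hn : 4 < Module.finrank ℝ V) {N : ℕ} (α : Fin N → (V →ₗ[ℝ] V)) (hα : ∀ k, α k ∈ g)
    (hon : ∀ k l, ip (α k) (α l) = if k = l then 1 else 0)
    (hpar : ∀ A ∈ g, A = ∑ k, ip A (α k) • α k)
    (F : V →ₗ[ℝ] V) (hF : IsSkew F)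
    (hFbr : ∀ Z ∈ perp g, br F Z ∈ g)
    (hL : ∑ k, ip F (α k) • α k + ∑ k, α k * F * α k = 0) : F = 0 := by
  by_contra hF0
  have hXex := exists_onb (perp g)
  obtain ⟨M, hM⟩ : ∃ M, M = Module.finrank ℝ (perp g) := ⟨_, rfl⟩
  rw [← hM] at hXex
  obtain ⟨X, hX, honX, hparX⟩ := hXex
  set n := Module.finrank ℝ V with hnn
  have hαs := fun k => hsk _ (hα k)
  have hXs := fun l => (hX l).1
  have hX1 : ∀ l, ip (X l) (X l) = 1 := fun l => by rw [honX]; simp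
  have hα1 : ∀ l, ip (α l) (α l) = 1 := fun l => by rw [hon]; simp
  have hdec : ∀ Z, IsSkew Z → (∑ k, ip Z (α k) • α k) ∈ g ∧ Z - ∑ k, ip Z (α k) • α k ∈ perp g := by
    intro Z hZ
    have h1 : (∑ k, ip Z (α k) • α k) ∈ g := Submodule.sum_mem _ fun l _ => g.smul_mem _ (hα l)
    refine ⟨h1, (so V).sub_mem hZ (hsk _ h1), ?_⟩
    intro A hA
    have h : ∀ k, ip (Z - ∑ l, ip Z (α l) • α l) (α k) = 0 := by
      intro k
      simp [hon]
    rw [hpar A hA]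
    simp only [map_sum, map_smul, h]; simp
  let β : Fin N ⊕ Fin M → (V →ₗ[ℝ] V) := Sum.elim α X
  have hβs : ∀ k, IsSkew (β k) := by rintro (k | k); exacts [hαs k, hXs k]
  have hβ1 : ∀ k, ip (β k) (β k) = 1 := by rintro (k | k); exacts [hα1 k, hX1 k]
  have hβpar : ∀ Z, IsSkew Z → Z = ∑ k, ip Z (β k) • β k := by
    intro Z hZ
    obtain ⟨h1, h2⟩ := hdec Z hZ
    have h3 := hparX _ h2
    rw [Fintype.sum_sum_type]
    simp only [β, Sum.elim_inl, Sum.elim_inr]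
    have h4 : ∀ l, ip (Z - ∑ k, ip Z (α k) • α k) (X l) = ip Z (X l) := by
      intro l
      rw [map_sub, LinearMap.sub_apply, ip_comm _ (X l), ip_comm _ (X l), (hX l).2 _ h1, sub_zero]
    simp only [h4] at h3
    rw [← h3]; abel
  have hfull := full_cas β hβs hβpar F hF
  rw [Fintype.sum_sum_type] at hfull
  simp only [β, Sum.elim_inl, Sum.elim_inr] at hfull
  obtain ⟨c, hc⟩ := cas_scalar g hsk hgg hirr hn α hα hpar
  have t1 := trace_sq α hαs hα1 c hc
  have t2 := trace_sq β hβs hβ1 _ (full_sq β hβs hβpar)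
  simp only [Fintype.card_sum, Fintype.card_fin, ← hnn] at t1 t2 hfull
  push_cast at t2
  set Fg := ∑ k, ip F (α k) • α k with hFg
  obtain ⟨hFgm, hFm⟩ := hdec F hF
  rw [← hFg] at hFgm hFm
  have hFgs := hsk _ hFgm
  have hcasF : ∑ k, br (α k) (br (α k) F) = (-(2 * c)) • F + (2:ℝ) • Fg := by
    rw [cas_expand, hc, eq_neg_of_add_eq_zero_right hL]
    simp only [smul_mul_assoc, mul_smul_comm, one_mul, mul_one]
    module
  let S : Submodule ℝ (V →ₗ[ℝ] V) :=
    { carrier := {Z | ∀ Y ∈ perp g, br Z Y ∈ g}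
      add_mem' := by
        intro a b ha hb Y hY
        rw [add_br]; exact g.add_mem (ha Y hY) (hb Y hY)
      zero_mem' := by intro Y _; rw [zero_br]; exact g.zero_mem
      smul_mem' := by
        intro r a ha Y hY
        rw [smul_br]; exact g.smul_mem r (ha Y hY) }
  have hS : ∀ A ∈ g, ∀ Z ∈ S, br A Z ∈ S := by
    intro A hA Z hZ Y hY
    have h1 : br (br A Z) Y = br A (br Z Y) - br Z (br A Y) := by rw [br_jac A Z Y]; abel
    rw [h1]
    exact g.sub_mem (hgg A hA _ (hZ Y hY)) (hZ _ (br_mem_perp hsk hgg hA hY))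
  have hFS : F ∈ S := hFbr
  have hFgS : Fg ∈ S := by
    have h1 : ∑ k, br (α k) (br (α k) F) ∈ S :=
      Submodule.sum_mem _ fun k _ => hS _ (hα k) _ (hS _ (hα k) _ hFS)
    have h2 : Fg = (1/2 : ℝ) • (∑ k, br (α k) (br (α k) F) + (2 * c) • F) := by
      rw [hcasF]; module
    rw [h2]
    exact S.smul_mem _ (S.add_mem h1 (S.smul_mem _ hFS))
  have hdisj : ∀ Z ∈ g, Z ∈ perp g → Z = 0 := fun Z h1 h2 => ip_self_zero (h2.2 Z h1)
  have hFgX : ∀ l, br (X l) Fg = 0 := by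
    intro l
    rw [br_swap, hdisj _ (hFgS _ (hX l)) (br_mem_perp hsk hgg hFgm (hX l)), neg_zero]
  have hq : ip F Fg = ip Fg Fg := by
    have := hFm.2 _ hFgm
    rw [map_sub, LinearMap.sub_apply] at this
    linarith
  have hnpos : (4:ℝ) < n := by exact_mod_cast hn
  have hFg0 : Fg = 0 := by
    by_contra hne
    have hqne : ip Fg Fg ≠ 0 := fun h => hne (ip_self_zero h)
    have h1 := congrArg (fun Z => ip Z Fg) hfull
    simp only [map_add, LinearMap.add_apply, map_smul, LinearMap.smul_apply] at h1
    rw [sandwich_ip X hXs hF, hcasF] at h1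
    simp only [hFgX, map_zero, Finset.sum_const_zero, map_add, map_smul, LinearMap.add_apply,
      LinearMap.smul_apply, smul_eq_mul, hq] at h1
    have h2 : (c - (n - 1)) * ip Fg Fg = 0 := by linarith
    have h3 : c = n - 1 := by
      rcases mul_eq_zero.1 h2 with h | h
      · linarith
      · exact absurd h hqne
    have h4 : (M : ℝ) = 0 := by rw [h3] at t1; linarith
    have h5 : M = 0 := by exact_mod_cast h4
    rw [hM, Submodule.finrank_eq_zero] at h5
    obtain ⟨A, hA, hAg⟩ := hproper
    obtain ⟨k1, k2⟩ := hdec A hA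
    rw [h5, Submodule.mem_bot, sub_eq_zero] at k2
    exact hAg (by rw [k2]; exact k1)
  rw [hFg0, sub_zero] at hFm
  have hq0 : ip F F ≠ 0 := fun h => hF0 (ip_self_zero h)
  have hc4 : 2 * c = n - 2 := by
    have h1 := congrArg (fun Z => ip Z F) hfull
    have h2 := congrArg (fun Z => ip Z F) hcasF
    simp only [map_add, LinearMap.add_apply, map_smul, LinearMap.smul_apply] at h1 h2
    rw [sandwich_ip X hXs hF] at h1
    have h3 := h2
    rw [sandwich_ip α hαs hF] at h3
    rw [h2] at h1
    have h4 : ∑ l, ip (br (X l) F) (br (X l) F) = ∑ l, ∑ k, ip (br (X l) F) (α k) ^ 2 := by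
      apply Finset.sum_congr rfl
      intro l _
      have hm : br (X l) F ∈ g := by rw [br_swap]; exact g.neg_mem (hFbr _ (hX l))
      conv_lhs => arg 2; rw [hpar _ hm]
      simp only [map_sum, map_smul, smul_eq_mul, sq]
    have h5 : ∑ k, ip (br (α k) F) (br (α k) F) = ∑ k, ∑ l, ip (br (α k) F) (X l) ^ 2 := by
      apply Finset.sum_congr rfl
      intro k _
      have hm : br (α k) F ∈ perp g := br_mem_perp hsk hgg (hα k) hFm
      conv_lhs => arg 2; rw [hparX _ hm]
      simp only [map_sum, map_smul, smul_eq_mul, sq]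
    have h6 : ∀ k l, ip (br (X l) F) (α k) = - ip (br (α k) F) (X l) := by
      intro k l
      rw [ip_inv (hXs l) hF, ip_inv (hαs k) hF, br_swap (X l), map_neg]
    simp only [h6, neg_sq] at h4
    rw [Finset.sum_comm, ← h5] at h4
    rw [h4] at h1
    rw [hFg0] at h1 h3
    simp only [map_zero, LinearMap.zero_apply, smul_eq_mul] at h1 h3
    have h7 : (2 * c - (n - 2)) * ip F F = 0 := by linarith
    rcases mul_eq_zero.1 h7 with h | h
    · linarith
    · exact absurd h hq0
  have hMN : 2 * M = 2 * N + n := by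
    have : (2 * M : ℝ) = 2 * N + n := by
      have : c = (n - 2) / 2 := by linarith
      rw [this] at t1
      nlinarith
    exact_mod_cast this
  -- the submodule of m bracketing m into g
  set P' := S ⊓ perp g with hP'
  have hFP : F ∈ P' := ⟨hFS, hFm⟩
  have hgP : ∀ A ∈ g, ∀ Y ∈ P', br A Y ∈ P' := fun A hA Y hY =>
    ⟨hS A hA Y hY.1, br_mem_perp hsk hgg hA hY.2⟩
  have hQ : ∀ B ∈ perp g, (∀ Y ∈ P', ip B Y = 0) → ∀ Y ∈ P', br B Y = 0 := by
    intro B hB h Y hY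
    have h1 : br Y B ∈ g := hY.1 B hB
    have h2 : br Y B = 0 := by
      apply ip_self_zero
      rw [ip_inv hY.2.1 hB.1, h, neg_zero]
      rw [br_swap]; exact P'.neg_mem (hgP _ h1 Y hY)
    rw [br_swap, h2, neg_zero]
  let I : Submodule ℝ (V →ₗ[ℝ] V) :=
    { carrier := {Z | IsSkew Z ∧ ∀ Y ∈ P', br Z Y = 0}
      add_mem' := by
        intro a b ha hb
        exact ⟨(so V).add_mem ha.1 hb.1, fun Y hY => by rw [add_br, ha.2 Y hY, hb.2 Y hY, add_zero]⟩
      zero_mem' := ⟨(so V).zero_mem, fun Y _ => zero_br Y⟩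
      smul_mem' := by
        intro r a ha
        exact ⟨(so V).smul_mem r ha.1, fun Y hY => by rw [smul_br, ha.2 Y hY, smul_zero]⟩ }
  have hPdec : ∀ Z ∈ perp g, ∃ Q ∈ P', Z - Q ∈ perp g ∧ ∀ Y ∈ P', ip (Z - Q) Y = 0 := by
    intro Z hZ
    obtain ⟨Q, hQ1, hQ2⟩ := exists_decomp P' Z
    exact ⟨Q, hQ1, (perp g).sub_mem hZ hQ1.2, hQ2⟩
  have hstab : ∀ A ∈ I, ∀ B, IsSkew B → (∀ Y ∈ P', br B Y ∈ P') → br A B ∈ I := by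
    intro A hA B hB h
    refine ⟨br_skew hA.1 hB, fun Y hY => ?_⟩
    have h1 : br (br A B) Y = br A (br B Y) - br B (br A Y) := by rw [br_jac A B Y]; abel
    rw [h1, hA.2 _ (h Y hY), hA.2 _ hY, br_zero, sub_zero]
  have hid : ∀ A ∈ I, ∀ B, IsSkew B → br A B ∈ I := by
    intro A hA B hB
    obtain ⟨k1, k2⟩ := hdec B hB
    set B1 := ∑ k, ip B (α k) • α k
    obtain ⟨Q, hQ1, hQ2, hQ3⟩ := hPdec _ k2
    have e1 : B = B1 + (Q + (B - B1 - Q)) := by abel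
    rw [e1, br_add, br_add]
    refine I.add_mem ?_ (I.add_mem ?_ ?_)
    · exact hstab A hA _ (hsk _ k1) (hgP _ k1)
    · rw [hA.2 _ hQ1]; exact I.zero_mem
    · apply hstab A hA _ hQ2.1
      intro Y hY
      rw [hQ _ hQ2 hQ3 Y hY]; exact P'.zero_mem
  rcases so_simple hn I (fun A hA => hA.1) hid with h | h
  · have hmm : ∀ A ∈ perp g, ∀ B ∈ perp g, br A B ∈ g := by
      intro A hA B hB
      obtain ⟨Q, hQ1, hQ2, hQ3⟩ := hPdec A hA
      have h0 := h (A - Q) ⟨hQ2.1, hQ _ hQ2 hQ3⟩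
      rw [sub_eq_zero] at h0
      rw [h0]; exact hQ1.1 B hB
    obtain ⟨a, ha, hab, hfin⟩ := exists_abelian M (perp g) g hM.ge (fun A hA => hA.1) hsk hmm
      (fun A hA B hB => br_mem_perp' hsk hgg hB hA)
    have hgN : Module.finrank ℝ g ≤ N := by
      have h1 : g ≤ Submodule.span ℝ (Set.range α) := by
        intro A hA
        rw [hpar A hA]
        exact Submodule.sum_mem _ fun k _ => Submodule.smul_mem _ _ (Submodule.subset_span ⟨k, rfl⟩)
      have h2 := finrank_range_le_card (R := ℝ) α
      rw [Fintype.card_fin] at h2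
      exact (Submodule.finrank_mono h1).trans h2
    rw [← hM] at hfin
    have ha0 : a ≠ ⊥ := by
      rintro rfl
      rw [finrank_bot] at hfin; omega
    obtain ⟨e, f, he, hf, hef, hmem⟩ := exists_rank_two n ⊤ a (by rw [finrank_top])
      (fun A hA => (ha hA).1) hab (by
        intro A _ x hx
        rw [Submodule.top_orthogonal_eq_bot, Submodule.mem_bot] at hx
        rw [hx, map_zero]) ha0 (by rw [finrank_top]; omega)
    exact rank_two g hsk hgg hmm hirr hn e f he hf hef (ha hmem)
  · have h1 : ∀ Z, IsSkew Z → br Z F = 0 := fun Z hZ => (h Z hZ).2 F hFP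
    simp only [h1 _ (hαs _), h1 _ (hXs _), br_zero, Finset.sum_const_zero, add_zero] at hfull
    rcases smul_eq_zero.1 hfull.symm with h2 | h2
    · linarith
    · exact hF0 h2
theorem stmt_17
    (g : Submodule ℝ (V →ₗ[ℝ] V))
    (hgskew : ∀ A ∈ g, IsSkew A)
    (hglie : ∀ A ∈ g, ∀ B ∈ g, A ∘ₗ B - B ∘ₗ A ∈ g)
    (hproper : ∃ A : V →ₗ[ℝ] V, IsSkew A ∧ A ∉ g)
    (hirr : ∀ W : Submodule ℝ V, (∀ A ∈ g, ∀ x ∈ W, A x ∈ W) → W = ⊥ ∨ W = ⊤)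
    (hn : 4 < Module.finrank ℝ V)
    -- `α` is an orthonormal basis of `g ⊆ Λ²V`, defining `T^g = Σₖ αₖ ∧ αₖ`
    (N : ℕ) (α : Fin N → (V →ₗ[ℝ] V))
    (hα : ∀ k, α k ∈ g)
    (hon : ∀ k l, formInner (⇑(α k)) (⇑(α l)) = if k = l then 1 else 0)
    (hspan : ∀ A ∈ g, A ∈ Submodule.span ℝ (Set.range α))
    (F : V →ₗ[ℝ] V) (hF : IsSkew F)
    -- `[F, g^⊥] ⊆ g`
    (hFbr : ∀ G : V →ₗ[ℝ] V, IsSkew G → (∀ A ∈ g, formInner (⇑G) (⇑A) = 0) →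
      F ∘ₗ G - G ∘ₗ F ∈ g)
    -- `L*_F T^g = 0`
    (hLF : ∀ X Y : V,
      (∑ i, ∑ j ∈ Finset.Ioi i,
        ⟪F (stdOrthonormalBasis ℝ V i), stdOrthonormalBasis ℝ V j⟫ *
          (∑ k, wedgeSelf (α k) (stdOrthonormalBasis ℝ V i)
            (stdOrthonormalBasis ℝ V j) X Y)) = 0) :
    -- then `F = 0`
    F = 0 := by
  have hbreq : ∀ A B : V →ₗ[ℝ] V, A ∘ₗ B - B ∘ₗ A = br A B := fun A B => rfl
  have hon' : ∀ k l, ip (α k) (α l) = if k = l then 1 else 0 := by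
    intro k l
    rw [← ip_formInner (hgskew _ (hα k)) (hgskew _ (hα l)), hon]
  have hpar : ∀ A ∈ g, A = ∑ k, ip A (α k) • α k := by
    intro A hA
    have h := hspan A hA
    refine Submodule.span_induction (p := fun A _ => A = ∑ k, ip A (α k) • α k) ?_ ?_ ?_ ?_ h
    · rintro _ ⟨k, rfl⟩
      simp [hon']
    · simp
    · intro x y _ _ hx hy
      simp only [map_add, LinearMap.add_apply, add_smul, Finset.sum_add_distrib]
      rw [← hx, ← hy]
    · intro r x _ hx
      simp only [map_smul, LinearMap.smul_apply, smul_assoc, ← Finset.smul_sum]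
      rw [← hx]
  refine core g hgskew hglie hproper hirr hn α hα hon' hpar F hF ?_ ?_
  · intro Z hZ
    apply hFbr Z hZ.1
    intro A hA
    rw [ip_formInner hZ.1 (hgskew A hA), hZ.2 A hA]
  · ext x
    apply ext_inner_right ℝ
    intro y
    have h := hLF x y
    have h2 : ∑ k, 2 * (ip F (α k) * ⟪α k x, y⟫ + ⟪α k (F (α k x)), y⟫) = 0 := by
      rw [← h]
      simp only [← lstar_k hF (hgskew _ (hα _)), Finset.mul_sum]
      rw [Finset.sum_comm]
      apply Finset.sum_congr rfl
      intro i _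
      rw [Finset.sum_comm]
    rw [← Finset.mul_sum, Finset.sum_add_distrib] at h2
    simp only [LinearMap.add_apply, LinearMap.sum_apply, LinearMap.smul_apply, inner_add_left,
      sum_inner, inner_smul_left, Module.End.mul_apply, LinearMap.zero_apply, inner_zero_left]
    simpa using h2
end
end

section
/- Let g ⊆ so(V) be a Lie subalgebra acting irreducibly on V with n = dim V ≥ 9, and suppose the characteristic 4-form T^g is nonzero. Then the linear map Λ²V → Λ⁶V given by exterior multiplication with T^g, α ↦ α ∧ T^g, is injective. -/
open scoped RealInnerProductSpace BigOperators

noncomputable section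

variable {V : Type} [NormedAddCommGroup V] [InnerProductSpace ℝ V] [FiniteDimensional ℝ V]

set_option linter.unusedSimpArgs false
set_option linter.unusedSectionVars false

/-! ### Combinatorics of the alternation -/

lemma sum_perm_succ (n : ℕ) (f : Equiv.Perm (Fin (n+1)) → ℝ) :
    ∑ σ, f σ = ∑ p : Fin (n+1), ∑ τ : Equiv.Perm (Fin n), f (Equiv.Perm.decomposeFin.symm (p, τ)) := by
  rw [← Equiv.sum_comp Equiv.Perm.decomposeFin.symm, Fintype.sum_prod_type]

lemma alt4 {ι : Type} (T : ι → ι → ι → ι → ℝ) (h1 : ∀ a b c d, T b a c d = - T a b c d)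
    (h2 : ∀ a b c d, T a c b d = - T a b c d) (h3 : ∀ a b c d, T a b d c = - T a b c d)
    (u : Fin 4 → ι) (τ : Equiv.Perm (Fin 4)) :
    ((Equiv.Perm.sign τ : ℤ) : ℝ) * T (u (τ 0)) (u (τ 1)) (u (τ 2)) (u (τ 3))
      = T (u 0) (u 1) (u 2) (u 3) := by
  have hm : τ ∈ Submonoid.closure (Set.range fun i : Fin 3 => Equiv.swap i.castSucc i.succ) := by
    rw [Equiv.Perm.mclosure_swap_castSucc_succ]; trivial
  induction hm using Submonoid.closure_induction_right with
  | one => simp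
  | mul_right x hx y hy ih =>
    obtain ⟨i, rfl⟩ := hy
    rw [← ih, Equiv.Perm.sign_mul, Equiv.Perm.sign_swap (by exact (Fin.castSucc_lt_succ).ne)]
    fin_cases i
    · have e0 : (x * Equiv.swap (0:Fin 4) 1) 0 = x 1 := by simp
      have e1 : (x * Equiv.swap (0:Fin 4) 1) 1 = x 0 := by simp
      have e2 : (x * Equiv.swap (0:Fin 4) 1) 2 = x 2 := by simp; congr 1
      have e3 : (x * Equiv.swap (0:Fin 4) 1) 3 = x 3 := by simp; congr 1
      simp only [Fin.zero_eta, Fin.castSucc_zero, Fin.succ_zero_eq_one, e0, e1, e2, e3]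
      rw [h1]; simp
    · have e0 : (x * Equiv.swap (1:Fin 4) 2) 0 = x 0 := by simp; congr 1
      have e1 : (x * Equiv.swap (1:Fin 4) 2) 1 = x 2 := by simp
      have e2 : (x * Equiv.swap (1:Fin 4) 2) 2 = x 1 := by simp
      have e3 : (x * Equiv.swap (1:Fin 4) 2) 3 = x 3 := by simp; congr 1
      simp only [Fin.mk_one, Fin.castSucc_one, Fin.succ_one_eq_two, e0, e1, e2, e3]
      rw [h2]; simp
    · have e0 : (x * Equiv.swap (2:Fin 4) 3) 0 = x 0 := by simp; congr 1
      have e1 : (x * Equiv.swap (2:Fin 4) 3) 1 = x 1 := by simp; congr 1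
      have e2 : (x * Equiv.swap (2:Fin 4) 3) 2 = x 3 := by simp
      have e3 : (x * Equiv.swap (2:Fin 4) 3) 3 = x 2 := by simp
      have e4 : Fin.castSucc (⟨2, by decide⟩ : Fin 3) = (2 : Fin 4) := rfl
      have e5 : Fin.succ (⟨2, by decide⟩ : Fin 3) = (3 : Fin 4) := rfl
      simp only [e4, e5, e0, e1, e2, e3]
      rw [h3]; simp

lemma sum_perm6 {ι : Type} (F : ι → ι → ℝ) (T : ι → ι → ι → ι → ℝ)
    (hF : ∀ a b, F b a = - F a b)
    (h1 : ∀ a b c d, T b a c d = - T a b c d)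
    (h2 : ∀ a b c d, T a c b d = - T a b c d) (h3 : ∀ a b c d, T a b d c = - T a b c d)
    (v : Fin 6 → ι) :
    ∑ σ : Equiv.Perm (Fin 6), ((Equiv.Perm.sign σ : ℤ) : ℝ) *
      (F (v (σ 0)) (v (σ 1)) * T (v (σ 2)) (v (σ 3)) (v (σ 4)) (v (σ 5))) =
    48 * (F (v 0) (v 1) * T (v 2) (v 3) (v 4) (v 5)
      - F (v 0) (v 2) * T (v 1) (v 3) (v 4) (v 5)
      + F (v 0) (v 3) * T (v 1) (v 2) (v 4) (v 5)
      - F (v 0) (v 4) * T (v 1) (v 2) (v 3) (v 5)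
      + F (v 0) (v 5) * T (v 1) (v 2) (v 3) (v 4)
      + F (v 1) (v 2) * T (v 0) (v 3) (v 4) (v 5)
      - F (v 1) (v 3) * T (v 0) (v 2) (v 4) (v 5)
      + F (v 1) (v 4) * T (v 0) (v 2) (v 3) (v 5)
      - F (v 1) (v 5) * T (v 0) (v 2) (v 3) (v 4)
      + F (v 2) (v 3) * T (v 0) (v 1) (v 4) (v 5)
      - F (v 2) (v 4) * T (v 0) (v 1) (v 3) (v 5)
      + F (v 2) (v 5) * T (v 0) (v 1) (v 3) (v 4)
      + F (v 3) (v 4) * T (v 0) (v 1) (v 2) (v 5)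
      - F (v 3) (v 5) * T (v 0) (v 1) (v 2) (v 4)
      + F (v 4) (v 5) * T (v 0) (v 1) (v 2) (v 3)) := by
  have s6 : ∀ f : Equiv.Perm (Fin 6) → ℝ, ∑ σ, f σ = ∑ p : Fin 6, ∑ τ : Equiv.Perm (Fin 5),
    f (Equiv.Perm.decomposeFin.symm (p, τ)) := sum_perm_succ 5
  have s5 : ∀ f : Equiv.Perm (Fin 5) → ℝ, ∑ σ, f σ = ∑ p : Fin 5, ∑ τ : Equiv.Perm (Fin 4),
    f (Equiv.Perm.decomposeFin.symm (p, τ)) := sum_perm_succ 4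
  rw [s6]
  simp_rw [s5]
  have key : ∀ (p : Fin 6) (q : Fin 5) (τ : Equiv.Perm (Fin 4)),
      ((Equiv.Perm.sign (Equiv.Perm.decomposeFin.symm (p, Equiv.Perm.decomposeFin.symm (q, τ))) : ℤ) : ℝ) *
      (F (v (Equiv.Perm.decomposeFin.symm (p, Equiv.Perm.decomposeFin.symm (q, τ)) 0))
         (v (Equiv.Perm.decomposeFin.symm (p, Equiv.Perm.decomposeFin.symm (q, τ)) 1))
       * T (v (Equiv.Perm.decomposeFin.symm (p, Equiv.Perm.decomposeFin.symm (q, τ)) 2))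
         (v (Equiv.Perm.decomposeFin.symm (p, Equiv.Perm.decomposeFin.symm (q, τ)) 3))
         (v (Equiv.Perm.decomposeFin.symm (p, Equiv.Perm.decomposeFin.symm (q, τ)) 4))
         (v (Equiv.Perm.decomposeFin.symm (p, Equiv.Perm.decomposeFin.symm (q, τ)) 5))) =
      (if p = 0 then 1 else -1) * ((if q = 0 then 1 else -1) *
      (F (v p) (v (Equiv.swap 0 p q.succ)) *
        T (v (Equiv.swap 0 p (Equiv.swap 0 q 1).succ)) (v (Equiv.swap 0 p (Equiv.swap 0 q 2).succ))
          (v (Equiv.swap 0 p (Equiv.swap 0 q 3).succ)) (v (Equiv.swap 0 p (Equiv.swap 0 q 4).succ)))) := by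
    intro p q τ
    have hA := alt4 T h1 h2 h3 (fun i => v (Equiv.swap 0 p (Equiv.swap 0 q i.succ).succ)) τ
    have g0 : ∀ e : Equiv.Perm (Fin 5), Equiv.Perm.decomposeFin.symm (p, e) 0 = p := by simp
    have gs : ∀ (e : Equiv.Perm (Fin 5)) (i : Fin 5), Equiv.Perm.decomposeFin.symm (p, e) i.succ
        = Equiv.swap 0 p (e i).succ := by simp
    have k0 : Equiv.Perm.decomposeFin.symm (q, τ) 0 = q := by simp
    have ks : ∀ (i : Fin 4), Equiv.Perm.decomposeFin.symm (q, τ) i.succ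
        = Equiv.swap 0 q (τ i).succ := by simp
    rw [show (1 : Fin 6) = Fin.succ 0 from rfl, show (2 : Fin 6) = Fin.succ (Fin.succ 0) from rfl,
      show (3 : Fin 6) = Fin.succ (Fin.succ 1) from rfl, show (4 : Fin 6) = Fin.succ (Fin.succ 2) from rfl,
      show (5 : Fin 6) = Fin.succ (Fin.succ 3) from rfl]
    simp only [gs, g0, k0, ks, Equiv.Perm.decomposeFin.symm_sign]
    rw [show (1 : Fin 5) = Fin.succ 0 from rfl, show (2 : Fin 5) = Fin.succ 1 from rfl,
      show (3 : Fin 5) = Fin.succ 2 from rfl, show (4 : Fin 5) = Fin.succ 3 from rfl]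
    beta_reduce at hA
    rw [← hA]
    push_cast
    split_ifs <;> push_cast <;> ring
  simp_rw [key]
  simp only [Finset.sum_const, Finset.card_univ, Fintype.card_perm, Fintype.card_fin]
  simp only [Fin.sum_univ_six, Fin.sum_univ_five]
  have sw : ∀ (m : ℕ) [NeZero m] (p i : Fin m), Equiv.swap 0 p i = if i = 0 then p else if i = p then 0 else i :=
    fun m _ p i => Equiv.swap_apply_def _ _ _
  simp only [sw]
  simp only [Fin.reduceSucc, Fin.reduceEq, Fin.isValue, if_true, if_false]
  have hF' : ∀ a b : Fin 6, b < a → F (v a) (v b) = - F (v b) (v a) := fun a b _ => hF _ _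
  have h1' : ∀ (a b : Fin 6) c d, b < a → T (v a) (v b) c d = - T (v b) (v a) c d :=
    fun a b _ _ _ => h1 _ _ _ _
  have h2' : ∀ (a b : Fin 6) c d, b < a → T c (v a) (v b) d = - T c (v b) (v a) d :=
    fun a b _ _ _ => h2 _ _ _ _
  have h3' : ∀ (a b : Fin 6) c d, b < a → T c d (v a) (v b) = - T c d (v b) (v a) :=
    fun a b _ _ _ => h3 _ _ _ _
  simp (discharger := decide) only [hF', h1', h2', h3']
  simp only [Nat.factorial, nsmul_eq_mul]
  push_cast
  ring

/-! ### Contracting the vanishing 6-form with `F ⊗ T` -/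

lemma sum_fun_succ {ι : Type} [Fintype ι] (m : ℕ) (f : (Fin (m+1) → ι) → ℝ) :
    ∑ i, f i = ∑ a : ι, ∑ i : Fin m → ι, f (Fin.cons a i) := by
  rw [← Equiv.sum_comp (Fin.consEquiv (fun _ => ι)), Fintype.sum_prod_type]
  rfl

lemma sum_fun6 {ι : Type} [Fintype ι] (f : ι → ι → ι → ι → ι → ι → ℝ) :
    ∑ i : Fin 6 → ι, f (i 0) (i 1) (i 2) (i 3) (i 4) (i 5)
      = ∑ a, ∑ b, ∑ c, ∑ d, ∑ e, ∑ g, f a b c d e g := by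
  simp only [sum_fun_succ]
  simp only [Finset.univ_unique, Finset.sum_singleton]
  rfl

lemma reindex {ι : Type} [Fintype ι] (π : Equiv.Perm (Fin 6)) (H : (Fin 6 → ι) → ℝ) :
    ∑ i, H i = ∑ i : Fin 6 → ι, H (fun k => i (π k)) := by
  rw [← Equiv.sum_comp (Equiv.arrowCongr π.symm (Equiv.refl ι))]
  rfl

lemma core_s18 {n : ℕ} (hn : 9 ≤ n) (F : Fin n → Fin n → ℝ) (T : Fin n → Fin n → Fin n → Fin n → ℝ)
    (hF : ∀ a b, F b a = - F a b)
    (h1 : ∀ a b c d, T b a c d = - T a b c d)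
    (h2 : ∀ a b c d, T a c b d = - T a b c d) (h3 : ∀ a b c d, T a b d c = - T a b c d)
    (r : ℝ) (hr : ∀ a b, ∑ d, ∑ e, ∑ f, T a d e f * T b d e f = if a = b then r else 0)
    (hT : r ≠ 0)
    (h0 : ∀ v : Fin 6 → Fin n, F (v 0) (v 1) * T (v 2) (v 3) (v 4) (v 5)
      - F (v 0) (v 2) * T (v 1) (v 3) (v 4) (v 5)
      + F (v 0) (v 3) * T (v 1) (v 2) (v 4) (v 5)
      - F (v 0) (v 4) * T (v 1) (v 2) (v 3) (v 5)
      + F (v 0) (v 5) * T (v 1) (v 2) (v 3) (v 4)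
      + F (v 1) (v 2) * T (v 0) (v 3) (v 4) (v 5)
      - F (v 1) (v 3) * T (v 0) (v 2) (v 4) (v 5)
      + F (v 1) (v 4) * T (v 0) (v 2) (v 3) (v 5)
      - F (v 1) (v 5) * T (v 0) (v 2) (v 3) (v 4)
      + F (v 2) (v 3) * T (v 0) (v 1) (v 4) (v 5)
      - F (v 2) (v 4) * T (v 0) (v 1) (v 3) (v 5)
      + F (v 2) (v 5) * T (v 0) (v 1) (v 3) (v 4)
      + F (v 3) (v 4) * T (v 0) (v 1) (v 2) (v 5)
      - F (v 3) (v 5) * T (v 0) (v 1) (v 2) (v 4)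
      + F (v 4) (v 5) * T (v 0) (v 1) (v 2) (v 3) = 0) (a b : Fin n) : F a b = 0 := by
  have hF' : ∀ (v : Fin 6 → Fin n) (a b : Fin 6), b < a → F (v a) (v b) = - F (v b) (v a) :=
    fun v a b _ => hF _ _
  have h1' : ∀ (v : Fin 6 → Fin n) (a b : Fin 6) c d, b < a →
    T (v a) (v b) c d = - T (v b) (v a) c d := fun v a b _ _ _ => h1 _ _ _ _
  have h2' : ∀ (v : Fin 6 → Fin n) (a b : Fin 6) c d, b < a →
    T c (v a) (v b) d = - T c (v b) (v a) d := fun v a b _ _ _ => h2 _ _ _ _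
  have h3' : ∀ (v : Fin 6 → Fin n) (a b : Fin 6) c d, b < a →
    T c d (v a) (v b) = - T c d (v b) (v a) := fun v a b _ _ _ => h3 _ _ _ _
  set Q : (Fin 6 → Fin n) → ℝ := fun v => F (v 0) (v 1) * T (v 2) (v 3) (v 4) (v 5) with hQ
  set C1 : ℝ := ∑ v : Fin 6 → Fin n,
    F (v 0) (v 1) * F (v 0) (v 2) * T (v 1) (v 3) (v 4) (v 5) * T (v 2) (v 3) (v 4) (v 5) with hC1
  set C2 : ℝ := ∑ v : Fin 6 → Fin n,
    F (v 0) (v 1) * F (v 2) (v 3) * T (v 0) (v 1) (v 4) (v 5) * T (v 2) (v 3) (v 4) (v 5) with hC2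
  have t02 : ∑ v, Q v * (F (v 0) (v 2) * T (v 1) (v 3) (v 4) (v 5)) = C1 := by
    rw [hC1]
    refine Finset.sum_congr rfl fun v _ => ?_
    simp only [hQ]; ring
  have t03 : ∑ v, Q v * (F (v 0) (v 3) * T (v 1) (v 2) (v 4) (v 5)) = -C1 := by
    rw [reindex (Equiv.swap 2 3), hC1, ← Finset.sum_neg_distrib]
    refine Finset.sum_congr rfl fun v _ => ?_
    simp only [hQ, Equiv.Perm.mul_apply, Equiv.swap_apply_def, Fin.reduceEq, Fin.isValue, if_true, if_false]
    simp (discharger := decide) only [hF', h1', h2', h3']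
    ring
  have t04 : ∑ v, Q v * (F (v 0) (v 4) * T (v 1) (v 2) (v 3) (v 5)) = C1 := by
    rw [reindex (Equiv.swap 2 4), hC1]
    refine Finset.sum_congr rfl fun v _ => ?_
    simp only [hQ, Equiv.Perm.mul_apply, Equiv.swap_apply_def, Fin.reduceEq, Fin.isValue, if_true, if_false]
    simp (discharger := decide) only [hF', h1', h2', h3']
    ring
  have t05 : ∑ v, Q v * (F (v 0) (v 5) * T (v 1) (v 2) (v 3) (v 4)) = -C1 := by
    rw [reindex (Equiv.swap 2 5), hC1, ← Finset.sum_neg_distrib]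
    refine Finset.sum_congr rfl fun v _ => ?_
    simp only [hQ, Equiv.Perm.mul_apply, Equiv.swap_apply_def, Fin.reduceEq, Fin.isValue, if_true, if_false]
    simp (discharger := decide) only [hF', h1', h2', h3']
    ring
  have t12 : ∑ v, Q v * (F (v 1) (v 2) * T (v 0) (v 3) (v 4) (v 5)) = -C1 := by
    rw [reindex (Equiv.swap 0 1), hC1, ← Finset.sum_neg_distrib]
    refine Finset.sum_congr rfl fun v _ => ?_
    simp only [hQ, Equiv.Perm.mul_apply, Equiv.swap_apply_def, Fin.reduceEq, Fin.isValue, if_true, if_false]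
    simp (discharger := decide) only [hF', h1', h2', h3']
    ring
  have t13 : ∑ v, Q v * (F (v 1) (v 3) * T (v 0) (v 2) (v 4) (v 5)) = C1 := by
    rw [reindex (Equiv.swap 0 1 * Equiv.swap 2 3), hC1]
    refine Finset.sum_congr rfl fun v _ => ?_
    simp only [hQ, Equiv.Perm.mul_apply, Equiv.swap_apply_def, Fin.reduceEq, Fin.isValue, if_true, if_false]
    simp (discharger := decide) only [hF', h1', h2', h3']
    ring
  have t14 : ∑ v, Q v * (F (v 1) (v 4) * T (v 0) (v 2) (v 3) (v 5)) = -C1 := by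
    rw [reindex (Equiv.swap 0 1 * Equiv.swap 2 4), hC1, ← Finset.sum_neg_distrib]
    refine Finset.sum_congr rfl fun v _ => ?_
    simp only [hQ, Equiv.Perm.mul_apply, Equiv.swap_apply_def, Fin.reduceEq, Fin.isValue, if_true, if_false]
    simp (discharger := decide) only [hF', h1', h2', h3']
    ring
  have t15 : ∑ v, Q v * (F (v 1) (v 5) * T (v 0) (v 2) (v 3) (v 4)) = C1 := by
    rw [reindex (Equiv.swap 0 1 * Equiv.swap 2 5), hC1]
    refine Finset.sum_congr rfl fun v _ => ?_
    simp only [hQ, Equiv.Perm.mul_apply, Equiv.swap_apply_def, Fin.reduceEq, Fin.isValue, if_true, if_false]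
    simp (discharger := decide) only [hF', h1', h2', h3']
    ring
  have t24 : ∑ v, Q v * (F (v 2) (v 4) * T (v 0) (v 1) (v 3) (v 5)) = -C2 := by
    rw [reindex (Equiv.swap 3 4), hC2, ← Finset.sum_neg_distrib]
    refine Finset.sum_congr rfl fun v _ => ?_
    simp only [hQ, Equiv.Perm.mul_apply, Equiv.swap_apply_def, Fin.reduceEq, Fin.isValue, if_true, if_false]
    simp (discharger := decide) only [hF', h1', h2', h3']
    ring
  have t25 : ∑ v, Q v * (F (v 2) (v 5) * T (v 0) (v 1) (v 3) (v 4)) = C2 := by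
    rw [reindex (Equiv.swap 3 5), hC2]
    refine Finset.sum_congr rfl fun v _ => ?_
    simp only [hQ, Equiv.Perm.mul_apply, Equiv.swap_apply_def, Fin.reduceEq, Fin.isValue, if_true, if_false]
    simp (discharger := decide) only [hF', h1', h2', h3']
    ring
  have t34 : ∑ v, Q v * (F (v 3) (v 4) * T (v 0) (v 1) (v 2) (v 5)) = C2 := by
    rw [reindex (Equiv.swap 2 4), hC2]
    refine Finset.sum_congr rfl fun v _ => ?_
    simp only [hQ, Equiv.Perm.mul_apply, Equiv.swap_apply_def, Fin.reduceEq, Fin.isValue, if_true, if_false]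
    simp (discharger := decide) only [hF', h1', h2', h3']
    ring
  have t35 : ∑ v, Q v * (F (v 3) (v 5) * T (v 0) (v 1) (v 2) (v 4)) = -C2 := by
    rw [reindex (Equiv.swap 2 5), hC2, ← Finset.sum_neg_distrib]
    refine Finset.sum_congr rfl fun v _ => ?_
    simp only [hQ, Equiv.Perm.mul_apply, Equiv.swap_apply_def, Fin.reduceEq, Fin.isValue, if_true, if_false]
    simp (discharger := decide) only [hF', h1', h2', h3']
    ring
  have t45 : ∑ v, Q v * (F (v 4) (v 5) * T (v 0) (v 1) (v 2) (v 3)) = C2 := by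
    rw [reindex (Equiv.swap 2 4 * Equiv.swap 3 5), hC2]
    refine Finset.sum_congr rfl fun v _ => ?_
    simp only [hQ, Equiv.Perm.mul_apply, Equiv.swap_apply_def, Fin.reduceEq, Fin.isValue, if_true, if_false]
    simp (discharger := decide) only [hF', h1', h2', h3']
    ring
  have t23 : ∑ v, Q v * (F (v 2) (v 3) * T (v 0) (v 1) (v 4) (v 5)) = C2 := by
    rw [hC2]
    refine Finset.sum_congr rfl fun v _ => ?_
    simp only [hQ]; ring
  have hsum : ∑ v, Q v * Q v = 8 * C1 - 6 * C2 := by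
    have hz : ∑ v : Fin 6 → Fin n, Q v * 0 = 0 := by simp
    rw [← Finset.sum_congr rfl (fun v _ => congrArg (Q v * ·) (h0 v))] at hz
    simp only [mul_add, mul_sub, Finset.sum_add_distrib, Finset.sum_sub_distrib] at hz
    rw [t02, t03, t04, t05, t12, t13, t14, t15, t23, t24, t25, t34, t35, t45] at hz
    have : ∑ v, Q v * Q v = ∑ v, Q v * (F (v 0) (v 1) * T (v 2) (v 3) (v 4) (v 5)) := rfl
    linarith
  set f2 : ℝ := ∑ a, ∑ b, F a b * F a b with hf2
  have e0 : ∑ v, Q v * Q v = f2 * (n * r) := by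
    have e := sum_fun6 (fun a b c d e f => (F a b * T c d e f) * (F a b * T c d e f))
    have e' : ∑ c, ∑ d, ∑ e, ∑ f, T c d e f * T c d e f = n * r := by
      simp [hr]
    rw [← e', hf2, Finset.sum_mul]
    refine e.trans (Finset.sum_congr rfl fun a _ => ?_)
    rw [Finset.sum_mul]
    refine Finset.sum_congr rfl fun b _ => ?_
    simp only [Finset.mul_sum]
    refine Finset.sum_congr rfl fun _ _ => Finset.sum_congr rfl fun _ _ =>
      Finset.sum_congr rfl fun _ _ => Finset.sum_congr rfl fun _ _ => ?_
    ring
  have e1 : C1 = f2 * r := by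
    have e := sum_fun6 (fun a b c d e f => F a b * F a c * T b d e f * T c d e f)
    rw [hf2, Finset.sum_mul]
    refine e.trans (Finset.sum_congr rfl fun a _ => ?_)
    rw [Finset.sum_mul]
    refine Finset.sum_congr rfl fun b _ => ?_
    have : ∀ c, ∑ d, ∑ e, ∑ f, F a b * F a c * T b d e f * T c d e f
        = F a b * F a c * (if b = c then r else 0) := by
      intro c
      rw [← hr]
      simp only [Finset.mul_sum, mul_assoc]
    rw [Finset.sum_congr rfl (fun c _ => this c)]
    simp
  have e2 : 0 ≤ C2 := by
    have e := sum_fun6 (fun a b c d e f => F a b * F c d * T a b e f * T c d e f)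
    have e' : C2 = ∑ e, ∑ f, (∑ a, ∑ b, F a b * T a b e f) ^ 2 := by
      rw [hC2]
      have e3 := reindex (ι := Fin n) (Equiv.swap 0 4 * Equiv.swap 1 5) (fun v =>
        F (v 0) (v 1) * F (v 2) (v 3) * T (v 0) (v 1) (v 4) (v 5) * T (v 2) (v 3) (v 4) (v 5))
      rw [e3]
      simp only [Equiv.Perm.mul_apply, Equiv.swap_apply_def, Fin.reduceEq, Fin.isValue, if_true, if_false]
      have e4 := sum_fun6 (fun a b c d e f => F e f * F c d * T e f a b * T c d a b)
      refine e4.trans (Finset.sum_congr rfl fun a _ => Finset.sum_congr rfl fun b _ => ?_)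
      simp only [sq, Finset.sum_mul, Finset.mul_sum]
      refine Finset.sum_congr rfl fun _ _ => Finset.sum_congr rfl fun _ _ =>
        Finset.sum_congr rfl fun _ _ => Finset.sum_congr rfl fun _ _ => ?_
      ring
    rw [e']
    positivity
  have hrpos : 0 < r := by
    have h := hr a a
    rw [if_pos rfl] at h
    refine lt_of_le_of_ne ?_ hT.symm
    rw [← h]
    refine Finset.sum_nonneg fun _ _ => Finset.sum_nonneg fun _ _ => Finset.sum_nonneg fun _ _ =>
      mul_self_nonneg _
  have hf2n : 0 ≤ f2 := Finset.sum_nonneg fun _ _ => Finset.sum_nonneg fun _ _ => mul_self_nonneg _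
  have hn' : (9 : ℝ) ≤ n := by exact_mod_cast hn
  have hz : f2 = 0 := by
    rw [e0, e1] at hsum
    have : f2 * r * (n - 8) ≤ 0 := by linarith
    by_contra hne
    have hp : 0 < f2 := lt_of_le_of_ne hf2n (Ne.symm hne)
    have : 0 < f2 * r * (n - 8) := mul_pos (mul_pos hp hrpos) (by linarith)
    linarith
  rw [hf2, Finset.sum_eq_zero_iff_of_nonneg
    (fun _ _ => Finset.sum_nonneg fun _ _ => mul_self_nonneg _)] at hz
  have hz' := hz a (Finset.mem_univ _)
  rw [Finset.sum_eq_zero_iff_of_nonneg (fun _ _ => mul_self_nonneg _)] at hz'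
  exact mul_self_eq_zero.mp (hz' b (Finset.mem_univ _))

/-! ### Invariance of `T` and Schur's lemma -/

lemma lin_expand {ι : Type} [Fintype ι] (e : OrthonormalBasis ι ℝ V) (f : V → ℝ)
    (hf : IsLinearMap ℝ f) (x : V) : f x = ∑ m, ⟪e m, x⟫ * f (e m) := by
  have h := congrArg (hf.mk' f) (e.sum_repr' x)
  rw [map_sum] at h
  simp only [map_smul, IsLinearMap.mk'_apply, smul_eq_mul] at h
  exact h.symm

lemma skew_sum {ι : Type} [Fintype ι] (e : OrthonormalBasis ι ℝ V) (A : V →ₗ[ℝ] V) (hA : IsSkew A)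
    (f g : V → ℝ) (hf : IsLinearMap ℝ f) (hg : IsLinearMap ℝ g) :
    ∑ j, f (A (e j)) * g (e j) = - ∑ j, f (e j) * g (A (e j)) := by
  have h1 : ∀ j, f (A (e j)) * g (e j) = ∑ m, ⟪e m, A (e j)⟫ * f (e m) * g (e j) := by
    intro j; rw [lin_expand e f hf (A (e j)), Finset.sum_mul]
  have h2 : ∀ j, f (e j) * g (A (e j)) = ∑ m, ⟪e m, A (e j)⟫ * f (e j) * g (e m) := by
    intro j; rw [lin_expand e g hg (A (e j)), Finset.mul_sum]
    exact Finset.sum_congr rfl fun _ _ => by ring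
  rw [Finset.sum_congr rfl (fun j _ => h1 j), Finset.sum_congr rfl (fun j _ => h2 j),
    Finset.sum_comm, ← Finset.sum_neg_distrib]
  refine Finset.sum_congr rfl fun i _ => ?_
  rw [← Finset.sum_neg_distrib]
  refine Finset.sum_congr rfl fun j _ => ?_
  have : ⟪e i, A (e j)⟫ = - ⟪e j, A (e i)⟫ := by
    have := hA (e i) (e j)
    rw [real_inner_comm] at this
    linarith
  rw [this]; ring

lemma formInner_eq (F G : V →ₗ[ℝ] V) (hF : IsSkew F) (hG : IsSkew G) :
    2 * formInner F G = ∑ i, ⟪F (stdOrthonormalBasis ℝ V i), G (stdOrthonormalBasis ℝ V i)⟫ := by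
  set e := stdOrthonormalBasis ℝ V with he
  set a : Fin (Module.finrank ℝ V) → Fin (Module.finrank ℝ V) → ℝ :=
    fun i j => ⟪F (e i), e j⟫ * ⟪G (e i), e j⟫ with ha
  have hsymm : ∀ i j, a i j = a j i := by
    intro i j
    simp only [ha]
    rw [hF (e i), hG (e i), real_inner_comm, real_inner_comm (G (e j))]
    ring
  have hdiag : ∀ i, a i i = 0 := by
    intro i
    have := hF (e i) (e i)
    rw [real_inner_comm] at this
    have h0 : ⟪F (e i), e i⟫ = 0 := by rw [real_inner_comm]; linarith
    simp [ha, h0]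
  have h1 : ∀ i, ⟪F (e i), G (e i)⟫ = ∑ j, a i j := by
    intro i
    rw [← e.sum_inner_mul_inner]
    exact Finset.sum_congr rfl fun j _ => by rw [real_inner_comm (G (e i)) (e j)]
  have h2 : ∀ i, ∑ j, a i j = ∑ j ∈ Finset.Ioi i, a i j + ∑ j ∈ Finset.Iio i, a i j := by
    intro i
    have : (Finset.univ : Finset (Fin (Module.finrank ℝ V))) =
        insert i (Finset.Ioi i ∪ Finset.Iio i) := by
      ext j
      simp only [Finset.mem_univ, Finset.mem_insert, Finset.mem_union, Finset.mem_Ioi,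
        Finset.mem_Iio, true_iff]
      rcases lt_trichotomy i j with h | h | h
      · exact Or.inr (Or.inl h)
      · exact Or.inl h.symm
      · exact Or.inr (Or.inr h)
    rw [this, Finset.sum_insert (by simp), hdiag, zero_add, Finset.sum_union]
    rw [Finset.disjoint_left]
    intro j hj hj'
    simp at hj hj'
    exact absurd hj (not_lt_of_gt hj')
  have h3 : ∑ i, ∑ j ∈ Finset.Iio i, a i j = ∑ i, ∑ j ∈ Finset.Ioi i, a i j := by
    rw [Finset.sum_comm' (t' := Finset.univ) (s' := fun j => Finset.Ioi j) (by simp)]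
    exact Finset.sum_congr rfl fun i _ => Finset.sum_congr rfl fun j _ => hsymm _ _
  rw [Finset.sum_congr rfl (fun i _ => (h1 i).trans (h2 i)), Finset.sum_add_distrib, h3]
  change 2 * (∑ i, ∑ j ∈ Finset.Ioi i, a i j) = _
  ring

lemma isSkew_comm (A B : V →ₗ[ℝ] V) (hA : IsSkew A) (hB : IsSkew B) :
    IsSkew (A ∘ₗ B - B ∘ₗ A) := by
  intro x y
  simp only [LinearMap.sub_apply, LinearMap.comp_apply, inner_sub_left, inner_sub_right]
  rw [hA (B x), hB x, hB (A x), hA x]; ring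

lemma formInner_ad (A F G : V →ₗ[ℝ] V) (hA : IsSkew A) (hF : IsSkew F) (hG : IsSkew G) :
    formInner (⇑(A ∘ₗ F - F ∘ₗ A)) G = - formInner (⇑(A ∘ₗ G - G ∘ₗ A)) F := by
  have h1 := formInner_eq _ _ (isSkew_comm A F hA hF) hG
  have h2 := formInner_eq _ _ (isSkew_comm A G hA hG) hF
  set e := stdOrthonormalBasis ℝ V with he
  have h3 : ∑ i, ⟪(A ∘ₗ F - F ∘ₗ A) (e i), G (e i)⟫ = - ∑ i, ⟪(A ∘ₗ G - G ∘ₗ A) (e i), F (e i)⟫ := by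
    have h4 : ∑ i, ⟪F (A (e i)), G (e i)⟫ = - ∑ i, ⟪F (e i), G (A (e i))⟫ := by
      have h5 : ∀ x y, ⟪F x, G y⟫ = ∑ m, ⟪F x, e m⟫ * ⟪G y, e m⟫ := by
        intro x y
        rw [← e.sum_inner_mul_inner]
        exact Finset.sum_congr rfl fun j _ => by rw [real_inner_comm (G y) (e j)]
      simp only [h5]
      rw [Finset.sum_comm, Finset.sum_comm (f := fun i m => ⟪F (e i), e m⟫ * ⟪G (A (e i)), e m⟫),
        ← Finset.sum_neg_distrib]
      refine Finset.sum_congr rfl fun m _ => ?_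
      refine skew_sum e A hA (fun x => ⟪F x, e m⟫) (fun x => ⟪G x, e m⟫) ?_ ?_ <;>
      · constructor
        · intro x y; simp [inner_add_left]
        · intro c x; simp [inner_smul_left]
    rw [← Finset.sum_neg_distrib] at h4 ⊢
    have h6 : ∀ i, ⟪(A ∘ₗ F - F ∘ₗ A) (e i), G (e i)⟫ - -⟪(A ∘ₗ G - G ∘ₗ A) (e i), F (e i)⟫
       = - (⟪F (A (e i)), G (e i)⟫ - -⟪F (e i), G (A (e i))⟫) := by
      intro i
      simp only [LinearMap.sub_apply, LinearMap.comp_apply, inner_sub_left]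
      rw [hA (F (e i)), hA (G (e i)), real_inner_comm (A (F (e i))) (G (e i)),
        hA (F (e i)), real_inner_comm (F (e i)) (G (A (e i)))]
      ring
    have h7 : ∑ i, (⟪(A ∘ₗ F - F ∘ₗ A) (e i), G (e i)⟫ - -⟪(A ∘ₗ G - G ∘ₗ A) (e i), F (e i)⟫) = 0 := by
      rw [Finset.sum_congr rfl (fun i _ => h6 i), Finset.sum_neg_distrib, Finset.sum_sub_distrib, h4]
      simp
    rw [Finset.sum_sub_distrib] at h7
    linarith
  linarith

/-- Infinitesimal invariance of `T^g`. -/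
lemma T_inv (g : Submodule ℝ (V →ₗ[ℝ] V))
    (hgskew : ∀ A ∈ g, IsSkew A)
    (hglie : ∀ A ∈ g, ∀ B ∈ g, A ∘ₗ B - B ∘ₗ A ∈ g)
    (N : ℕ) (α : Fin N → (V →ₗ[ℝ] V))
    (hα : ∀ k, α k ∈ g)
    (hon : ∀ k l, formInner (⇑(α k)) (⇑(α l)) = if k = l then 1 else 0)
    (hspan : ∀ A ∈ g, A ∈ Submodule.span ℝ (Set.range α)) (A : V →ₗ[ℝ] V) (hA : A ∈ g)
    (x y z w : V) :
    (∑ k, wedgeSelf (α k) (A x) y z w) + (∑ k, wedgeSelf (α k) x (A y) z w) +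
    (∑ k, wedgeSelf (α k) x y (A z) w) + (∑ k, wedgeSelf (α k) x y z (A w)) = 0 := by
  have hex : ∀ k, ∃ c : Fin N → ℝ, ∑ l, c l • α l = A ∘ₗ α k - α k ∘ₗ A := fun k =>
    (Submodule.mem_span_range_iff_exists_fun ℝ).1 (hspan _ (hglie _ hA _ (hα k)))
  choose c hc using hex
  have hcoef : ∀ k l, c k l = formInner (⇑(A ∘ₗ α k - α k ∘ₗ A)) (α l) := by
    intro k l
    have hlin : formInner (⇑(∑ m, c k m • α m)) (⇑(α l)) = ∑ m, c k m * formInner (α m) (α l) := by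
      unfold formInner
      simp only [LinearMap.sum_apply, LinearMap.smul_apply, sum_inner, inner_smul_left, Finset.mul_sum,
        Finset.sum_mul]
      symm
      rw [Finset.sum_comm]
      refine Finset.sum_congr rfl fun i _ => ?_
      rw [Finset.sum_comm]
      refine Finset.sum_congr rfl fun j _ => Finset.sum_congr rfl fun m _ => ?_
      simp only [conj_trivial]; ring
    rw [← hc, hlin]
    simp [hon]
  have hanti : ∀ k l, c k l = - c l k := by
    intro k l
    rw [hcoef, hcoef]
    exact formInner_ad A _ _ (hgskew _ hA) (hgskew _ (hα k)) (hgskew _ (hα l))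
  set B : Fin N → V → V → ℝ := fun k x y => ⟪α k x, y⟫ with hB
  have hβ : ∀ k x y, B k (A x) y + B k x (A y) = - ∑ l, c k l * B l x y := by
    intro k x y
    have h := congrArg (fun M : V →ₗ[ℝ] V => ⟪M x, y⟫) (hc k)
    simp only [LinearMap.sum_apply, LinearMap.smul_apply, sum_inner, inner_smul_left,
      LinearMap.sub_apply, LinearMap.comp_apply, inner_sub_left] at h
    rw [hgskew _ hA (α k x)] at h
    simp only [hB]
    simp only [conj_trivial] at h
    linarith
  have hpair : ∀ x y z w, ∑ k, ((B k (A x) y + B k x (A y)) * B k z w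
      + B k x y * (B k (A z) w + B k z (A w))) = 0 := by
    intro x y z w
    simp only [hβ]
    have h1 : ∑ k, ∑ l, c k l * B l x y * B k z w = - ∑ k, ∑ l, c k l * B k x y * B l z w := by
      rw [Finset.sum_comm, ← Finset.sum_neg_distrib]
      refine Finset.sum_congr rfl fun k _ => ?_
      rw [← Finset.sum_neg_distrib]
      refine Finset.sum_congr rfl fun l _ => ?_
      rw [hanti l k]; ring
    rw [Finset.sum_add_distrib]
    have h2 : ∑ k, -(∑ l, c k l * B l x y) * B k z w = - ∑ k, ∑ l, c k l * B l x y * B k z w := by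
      rw [← Finset.sum_neg_distrib]
      refine Finset.sum_congr rfl fun k _ => ?_
      rw [neg_mul, Finset.sum_mul]
    have h3 : ∑ k, B k x y * -(∑ l, c k l * B l z w) = - ∑ k, ∑ l, c k l * B k x y * B l z w := by
      rw [← Finset.sum_neg_distrib]
      refine Finset.sum_congr rfl fun k _ => ?_
      rw [mul_neg, Finset.mul_sum]
      exact congrArg _ (Finset.sum_congr rfl fun l _ => by ring)
    rw [h2, h3, h1]; ring
  have e : ∀ k, wedgeSelf (α k) (A x) y z w + wedgeSelf (α k) x (A y) z w +
      wedgeSelf (α k) x y (A z) w + wedgeSelf (α k) x y z (A w) =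
      2 * (((B k (A x) y + B k x (A y)) * B k z w + B k x y * (B k (A z) w + B k z (A w))) -
       ((B k (A x) z + B k x (A z)) * B k y w + B k x z * (B k (A y) w + B k y (A w))) +
       ((B k (A x) w + B k x (A w)) * B k y z + B k x w * (B k (A y) z + B k y (A z)))) := by
    intro k; simp only [wedgeSelf, hB]; ring
  rw [← Finset.sum_add_distrib, ← Finset.sum_add_distrib, ← Finset.sum_add_distrib,
    Finset.sum_congr rfl (fun k _ => e k), ← Finset.mul_sum, Finset.sum_add_distrib,
    Finset.sum_sub_distrib, hpair, hpair, hpair]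
  simp

lemma schur (g : Submodule ℝ (V →ₗ[ℝ] V))
    (hgskew : ∀ A ∈ g, IsSkew A)
    (hirr : ∀ W : Submodule ℝ V, (∀ A ∈ g, ∀ x ∈ W, A x ∈ W) → W = ⊥ ∨ W = ⊤)
    (hn : 9 ≤ Module.finrank ℝ V)
    (T : V → V → V → V → ℝ)
    (l1 : ∀ y z w, IsLinearMap ℝ (fun x => T x y z w))
    (l2 : ∀ x z w, IsLinearMap ℝ (fun y => T x y z w))
    (l3 : ∀ x y w, IsLinearMap ℝ (fun z => T x y z w))
    (l4 : ∀ x y z, IsLinearMap ℝ (fun w => T x y z w))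
    (hinv : ∀ A ∈ g, ∀ x y z w, T (A x) y z w + T x (A y) z w + T x y (A z) w + T x y z (A w) = 0)
    {m : ℕ} (e : OrthonormalBasis (Fin m) ℝ V) :
    ∃ r : ℝ, ∀ a b, ∑ i, ∑ j, ∑ k, T a (e i) (e j) (e k) * T b (e i) (e j) (e k) = r * ⟪a, b⟫ := by
  set ρ : V → V → ℝ := fun a b => ∑ i, ∑ j, ∑ k, T a (e i) (e j) (e k) * T b (e i) (e j) (e k) with hρ
  have hsymm : ∀ a b, ρ a b = ρ b a := by
    intro a b; simp only [hρ]
    exact Finset.sum_congr rfl fun _ _ => Finset.sum_congr rfl fun _ _ =>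
      Finset.sum_congr rfl fun _ _ => mul_comm _ _
  have hlin : ∀ b, IsLinearMap ℝ (fun a => ρ a b) := by
    intro b
    constructor
    · intro x y
      simp only [hρ, (l1 _ _ _).map_add, add_mul, Finset.sum_add_distrib]
    · intro c x
      simp only [hρ, (l1 _ _ _).map_smul, smul_eq_mul, Finset.mul_sum, mul_assoc]
  have hlin' : ∀ a, IsLinearMap ℝ (fun b => ρ a b) := by
    intro a
    have : (fun b => ρ a b) = fun b => ρ b a := funext fun b => hsymm a b
    rw [this]; exact hlin a
  have hρinv : ∀ A ∈ g, ∀ a b, ρ (A a) b = - ρ a (A b) := by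
    intro A hA a b
    have hs := hgskew A hA
    have p1 : ∑ i, ∑ j, ∑ k, (T a (A (e i)) (e j) (e k) * T b (e i) (e j) (e k)
        + T a (e i) (e j) (e k) * T b (A (e i)) (e j) (e k)) = 0 := by
      rw [Finset.sum_comm]
      refine Finset.sum_eq_zero fun j _ => ?_
      rw [Finset.sum_comm]
      refine Finset.sum_eq_zero fun k _ => ?_
      have := skew_sum e A hs _ _ (l2 a (e j) (e k)) (l2 b (e j) (e k))
      rw [Finset.sum_add_distrib, this]; ring
    have p2 : ∑ i, ∑ j, ∑ k, (T a (e i) (A (e j)) (e k) * T b (e i) (e j) (e k)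
        + T a (e i) (e j) (e k) * T b (e i) (A (e j)) (e k)) = 0 := by
      refine Finset.sum_eq_zero fun i _ => ?_
      rw [Finset.sum_comm]
      refine Finset.sum_eq_zero fun k _ => ?_
      have := skew_sum e A hs _ _ (l3 a (e i) (e k)) (l3 b (e i) (e k))
      rw [Finset.sum_add_distrib, this]; ring
    have p3 : ∑ i, ∑ j, ∑ k, (T a (e i) (e j) (A (e k)) * T b (e i) (e j) (e k)
        + T a (e i) (e j) (e k) * T b (e i) (e j) (A (e k))) = 0 := by
      refine Finset.sum_eq_zero fun i _ => ?_
      refine Finset.sum_eq_zero fun j _ => ?_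
      have := skew_sum e A hs _ _ (l4 a (e i) (e j)) (l4 b (e i) (e j))
      rw [Finset.sum_add_distrib, this]; ring
    have tot : ρ (A a) b + ρ a (A b) + (∑ i, ∑ j, ∑ k, (T a (A (e i)) (e j) (e k) * T b (e i) (e j) (e k)
        + T a (e i) (e j) (e k) * T b (A (e i)) (e j) (e k)))
      + (∑ i, ∑ j, ∑ k, (T a (e i) (A (e j)) (e k) * T b (e i) (e j) (e k)
        + T a (e i) (e j) (e k) * T b (e i) (A (e j)) (e k)))
      + (∑ i, ∑ j, ∑ k, (T a (e i) (e j) (A (e k)) * T b (e i) (e j) (e k)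
        + T a (e i) (e j) (e k) * T b (e i) (e j) (A (e k)))) = 0 := by
      simp only [hρ, ← Finset.sum_add_distrib]
      refine Finset.sum_eq_zero fun i _ => Finset.sum_eq_zero fun j _ =>
        Finset.sum_eq_zero fun k _ => ?_
      have q1 := hinv A hA a (e i) (e j) (e k)
      have q2 := hinv A hA b (e i) (e j) (e k)
      linear_combination (T b (e i) (e j) (e k)) * q1 + (T a (e i) (e j) (e k)) * q2
    rw [p1, p2, p3] at tot
    linarith
  -- the symmetric operator representing `ρ`
  let R : V →ₗ[ℝ] V :=
    { toFun := fun a => ∑ i, ρ a (e i) • e i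
      map_add' := fun x y => by
        simp only [(hlin _).map_add, add_smul, Finset.sum_add_distrib]
      map_smul' := fun c x => by
        simp only [(hlin _).map_smul, smul_eq_mul, mul_smul, Finset.smul_sum, RingHom.id_apply] }
  have hR : ∀ a b, ⟪R a, b⟫ = ρ a b := by
    intro a b
    rw [lin_expand e (fun b => ρ a b) (hlin' a) b]
    change ⟪∑ i, ρ a (e i) • e i, b⟫ = _
    rw [sum_inner]
    refine Finset.sum_congr rfl fun i _ => ?_
    rw [real_inner_smul_left]; ring
  have hRs : R.IsSymmetric := by
    intro a b
    rw [hR, hsymm, ← hR, real_inner_comm]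
  have : Nontrivial V := Module.nontrivial_of_finrank_pos (R := ℝ) (by omega)
  have hev := hRs.hasEigenvalue_iSup_of_finiteDimensional
  obtain ⟨r, hr⟩ : ∃ r : ℝ, Module.End.HasEigenvalue R r := ⟨_, hev⟩
  have hcomm : ∀ A ∈ g, ∀ x, R (A x) = A (R x) := by
    intro A hA x
    refine ext_inner_right ℝ fun y => ?_
    rw [hR, hρinv A hA, hgskew A hA, hR]
  have htop : Module.End.eigenspace R r = ⊤ := by
    refine (hirr _ ?_).resolve_left hr
    intro A hA x hx
    rw [Module.End.mem_eigenspace_iff] at hx ⊢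
    rw [hcomm A hA, hx, map_smul]
  refine ⟨r, fun a b => ?_⟩
  have ha : a ∈ Module.End.eigenspace R r := by rw [htop]; trivial
  rw [Module.End.mem_eigenspace_iff] at ha
  change ρ a b = _
  rw [← hR, ha, real_inner_smul_left]

theorem stmt_18
    (g : Submodule ℝ (V →ₗ[ℝ] V))
    (hgskew : ∀ A ∈ g, IsSkew A)
    (hglie : ∀ A ∈ g, ∀ B ∈ g, A ∘ₗ B - B ∘ₗ A ∈ g)
    (hirr : ∀ W : Submodule ℝ V, (∀ A ∈ g, ∀ x ∈ W, A x ∈ W) → W = ⊥ ∨ W = ⊤)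
    (hn : 9 ≤ Module.finrank ℝ V)
    -- `α` is an orthonormal basis of `g ⊆ Λ²V`, defining `T^g = Σₖ αₖ ∧ αₖ`
    (N : ℕ) (α : Fin N → (V →ₗ[ℝ] V))
    (hα : ∀ k, α k ∈ g)
    (hon : ∀ k l, formInner (⇑(α k)) (⇑(α l)) = if k = l then 1 else 0)
    (hspan : ∀ A ∈ g, A ∈ Submodule.span ℝ (Set.range α))
    -- `T^g ≠ 0`
    (hTgne : ∃ X Y Z W : V, (∑ k, wedgeSelf (α k) X Y Z W) ≠ 0) :
    -- then exterior multiplication by `T^g` is injective on 2-forms: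
    -- a 2-form `F` with `F ∧ T^g = 0` vanishes
    ∀ F : V →ₗ[ℝ] V, IsSkew F →
      (∀ v : Fin 6 → V,
        (∑ σ : Equiv.Perm (Fin 6), ((Equiv.Perm.sign σ : ℤ) : ℝ) *
          (⟪F (v (σ 0)), v (σ 1)⟫ *
            ∑ k, wedgeSelf (α k) (v (σ 2)) (v (σ 3)) (v (σ 4)) (v (σ 5)))) = 0) →
      F = 0 := by
  intro F hF h0
  set T : V → V → V → V → ℝ := fun x y z w => ∑ k, wedgeSelf (α k) x y z w with hT
  have sk : ∀ k x y, ⟪α k y, x⟫ = - ⟪α k x, y⟫ := by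
    intro k x y
    rw [hgskew _ (hα k) y x, real_inner_comm]
  have l1 : ∀ y z w, IsLinearMap ℝ (fun x => T x y z w) := by
    intro y z w
    constructor
    · intro a b
      simp only [hT, ← Finset.sum_add_distrib]
      refine Finset.sum_congr rfl fun k _ => ?_
      simp only [wedgeSelf, map_add, inner_add_left, inner_add_right]; ring
    · intro c a
      simp only [hT, smul_eq_mul, Finset.mul_sum]
      refine Finset.sum_congr rfl fun k _ => ?_
      simp only [wedgeSelf, map_smul, real_inner_smul_left, real_inner_smul_right]; ring
  have h1 : ∀ a b c d, T b a c d = - T a b c d := by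
    intro a b c d
    simp only [hT, ← Finset.sum_neg_distrib]
    refine Finset.sum_congr rfl fun k _ => ?_
    simp only [wedgeSelf]
    rw [sk k a b]; ring
  have h2 : ∀ a b c d, T a c b d = - T a b c d := by
    intro a b c d
    simp only [hT, ← Finset.sum_neg_distrib]
    refine Finset.sum_congr rfl fun k _ => ?_
    simp only [wedgeSelf]
    rw [sk k b c]; ring
  have h3 : ∀ a b c d, T a b d c = - T a b c d := by
    intro a b c d
    simp only [hT, ← Finset.sum_neg_distrib]
    refine Finset.sum_congr rfl fun k _ => ?_
    simp only [wedgeSelf]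
    rw [sk k c d]; ring
  have l2 : ∀ x z w, IsLinearMap ℝ (fun y => T x y z w) := by
    intro x z w
    have : (fun y => T x y z w) = fun y => T y z x w := by
      funext y; rw [h2 y x z, h1 x y]; ring
    rw [this]; exact l1 _ _ _
  have l3 : ∀ x y w, IsLinearMap ℝ (fun z => T x y z w) := by
    intro x y w
    have : (fun z => T x y z w) = fun z => T x z w y := by
      funext z; rw [h3 x z y w, h2 x y z]; ring
    rw [this]; exact l2 _ _ _
  have l4 : ∀ x y z, IsLinearMap ℝ (fun w => T x y z w) := by
    intro x y z
    have : (fun w => T x y z w) = fun w => T y x w z := by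
      funext w; rw [h1 x y, h3 x y z w]; ring
    rw [this]; exact l3 _ _ _
  set e := stdOrthonormalBasis ℝ V with he
  obtain ⟨r, hr⟩ := schur g hgskew hirr hn T l1 l2 l3 l4
    (fun A hA x y z w => T_inv g hgskew hglie N α hα hon hspan A hA x y z w) e
  have hr0 : r ≠ 0 := by
    rintro rfl
    obtain ⟨X, Y, Z, W, hne⟩ := hTgne
    apply hne
    have hz : ∀ i j k, T X (e i) (e j) (e k) = 0 := by
      intro i j k
      have h := hr X X
      rw [zero_mul] at h
      have s1 := (Finset.sum_eq_zero_iff_of_nonneg (fun _ _ => Finset.sum_nonneg fun _ _ =>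
        Finset.sum_nonneg fun _ _ => mul_self_nonneg _)).1 h i (Finset.mem_univ _)
      have s2 := (Finset.sum_eq_zero_iff_of_nonneg (fun _ _ =>
        Finset.sum_nonneg fun _ _ => mul_self_nonneg _)).1 s1 j (Finset.mem_univ _)
      have s3 := (Finset.sum_eq_zero_iff_of_nonneg (fun _ _ => mul_self_nonneg _)).1 s2 k
        (Finset.mem_univ _)
      exact mul_self_eq_zero.mp s3
    have z1 : ∀ i j w, T X (e i) (e j) w = 0 := fun i j w => by
      rw [lin_expand e _ (l4 X (e i) (e j)) w]; simp [hz]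
    have z2 : ∀ i z w, T X (e i) z w = 0 := fun i z w => by
      rw [lin_expand e _ (l3 X (e i) w) z]; simp [z1]
    have z3 : ∀ y z w, T X y z w = 0 := fun y z w => by
      rw [lin_expand e _ (l2 X z w) y]; simp [z2]
    exact z3 Y Z W
  have hFs : ∀ x y, ⟪F y, x⟫ = - ⟪F x, y⟫ := by
    intro x y
    rw [hF y x, real_inner_comm]
  have hcore := core_s18 hn (fun i j => ⟪F (e i), e j⟫) (fun i j k l => T (e i) (e j) (e k) (e l))
    (fun a b => hFs _ _) (fun a b c d => h1 _ _ _ _) (fun a b c d => h2 _ _ _ _)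
    (fun a b c d => h3 _ _ _ _) r
    (fun a b => by
      rw [hr (e a) (e b), orthonormal_iff_ite.mp e.orthonormal a b]
      split_ifs <;> simp) hr0
    (fun v => by
      have h := h0 (fun i => e (v i))
      have h' := sum_perm6 (fun x y => ⟪F x, y⟫) T hFs h1 h2 h3 (fun i => e (v i))
      have h'' := h'.symm.trans h
      exact (mul_eq_zero.mp h'').resolve_left (by norm_num))
  refine e.toBasis.ext fun i => ?_
  rw [OrthonormalBasis.coe_toBasis, LinearMap.zero_apply]
  rw [← e.sum_repr' (F (e i))]
  refine Finset.sum_eq_zero fun j _ => ?_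
  rw [real_inner_comm, show ⟪F (e i), e j⟫ = 0 from hcore i j, zero_smul]
end
end
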